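/- arXiv:1112.1183 — 2 statements merged into one kernel-verified Lean document; each statement's English description precedes it below -/
import Mathlib

section
/- Let β, β' > 1, let a_1 a_2 ⋯ be the (−β)-expansion of −β/(β+1) and a'_1 a'_2 ⋯ be the (−β')-expansion of −β'/(β'+1). Then β < β' if and only if a_1 a_2 ⋯ <_alt a'_1 a'_2 ⋯. -/
open Filter Set

/-- The (−β)-transformation on [−β/(β+1), 1/(β+1)). -/
noncomputable def negBetaT (β : ℝ) (x : ℝ) : ℝ := -β * x - ⌊β / (β + 1) - β * x⌋

/-- The digits of the (−β)-expansion of x; `negBetaDigit β x n` is ε_{n+1}(x). -/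
noncomputable def negBetaDigit (β : ℝ) (x : ℝ) (n : ℕ) : ℤ :=
  ⌊β / (β + 1) - β * ((negBetaT β)^[n] x)⌋

/-- The (−β)-expansion of the left endpoint −β/(β+1); index n represents a_{n+1}. -/
noncomputable def negBetaExp (β : ℝ) (n : ℕ) : ℤ := negBetaDigit β (-β / (β + 1)) n

/-- `b` is the (−β)-expansion of `x`. -/
def IsNegBetaExpOf (β : ℝ) (x : ℝ) (b : ℕ → ℤ) : Prop :=
  x ∈ Set.Ico (-β / (β + 1)) (1 / (β + 1)) ∧ ∀ n, b n = negBetaDigit β x n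

/-- Alternating lexicographic strict order (0-based indexing: index k corresponds
to position k+1, so `Even k` means odd position). -/
def AltLt (x y : ℕ → ℤ) : Prop :=
  ∃ k, (∀ i, i < k → x i = y i) ∧ (if Even k then x k < y k else y k < x k)

/-- Alternating lexicographic order. -/
def AltLe (x y : ℕ → ℤ) : Prop := AltLt x y ∨ x = y

def phiW : ℕ → List ℕ
  | 1 => [1, 0, 0]
  | _ => [1]

/-- `uWord n` is φ^n(1), where φ(1) = 100, φ(0) = 1. -/
def uWord : ℕ → List ℕ
  | 0 => [1]
  | n + 1 => (uWord n).flatMap phiW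

/-- The sequence u = 100111001001001110011⋯ starting with φ^n(1) for all n. -/
def uSeq (n : ℕ) : ℤ := ((uWord (n + 1)).getD n 0 : ℕ)

/-- Condition (G): every shifted sequence is ≤_alt the sequence itself. -/
def CondG (a : ℕ → ℤ) : Prop := ∀ k, 1 ≤ k → AltLe (fun n => a (n + k)) a

/-- Condition (L): a >_alt u. -/
def CondL (a : ℕ → ℤ) : Prop := AltLt uSeq a

/-- The periodic sequence (w)^∞. -/
def perSeq (w : List ℤ) : ℕ → ℤ := fun n => w.getD (n % w.length) 0

/-- `a` is an infinite concatenation of blocks from `S`. -/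
def IsInfConcat (S : Set (List ℤ)) (a : ℕ → ℤ) : Prop :=
  ∃ w : ℕ → List ℤ, (∀ n, w n ∈ S) ∧
    ∀ N i, i < (((List.range N).map w).flatten).length →
      (((List.range N).map w).flatten).getD i 0 = a i

/-- Condition (A1). -/
def CondA1 (a : ℕ → ℤ) : Prop :=
  ∀ k, 1 ≤ k → AltLt uSeq (perSeq ((List.range k).map a)) →
    IsInfConcat {(List.range k).map a, (List.range (k - 1)).map a ++ [a (k - 1) - 1, 0]} a →
    a = perSeq ((List.range k).map a)

/-- Condition (A2). -/
def CondA2 (a : ℕ → ℤ) : Prop :=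
  ∀ k, 1 ≤ k → AltLt uSeq (perSeq ((List.range (k - 1)).map a ++ [a (k - 1) + 1])) →
    ¬ IsInfConcat {(List.range k).map a ++ [0], (List.range (k - 1)).map a ++ [a (k - 1) + 1]} a

/-- The cylinder set I_{b_1⋯b_n}. -/
def cylinder (β : ℝ) (w : List ℤ) : Set ℝ :=
  {x | x ∈ Set.Ico (-β / (β + 1)) (1 / (β + 1)) ∧
    ∀ i, i < w.length → negBetaDigit β x i = w.getD i 0}

/-- L_{β,n}: the number of words of length n with nonempty cylinder. -/
noncomputable def Lnum (β : ℝ) (n : ℕ) : ℕ :=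
  Set.ncard {w : List ℤ | w.length = n ∧ (cylinder β w).Nonempty}

/-- L'_{β,n}: the number of words of length n whose cylinder is an interval of
positive length. -/
noncomputable def Lnum' (β : ℝ) (n : ℕ) : ℕ :=
  Set.ncard {w : List ℤ | w.length = n ∧
    ∃ c d : ℝ, c < d ∧ Set.Ioo c d ⊆ cylinder β w ∧ cylinder β w ⊆ Set.Icc c d}

/-- P_n(x) = (−x)^n + Σ_{j=1}^n (a_j+1)(−x)^{n−j}. -/
noncomputable def Pn (a : ℕ → ℤ) (n : ℕ) (x : ℝ) : ℝ :=
  (-x) ^ n + ∑ j ∈ Finset.range n, ((a j : ℝ) + 1) * (-x) ^ (n - 1 - j)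

/-- J_n = {x > 1 : P_j(x) ∈ [0,1] for all 1 ≤ j ≤ n}. -/
def Jn (a : ℕ → ℤ) (n : ℕ) : Set ℝ :=
  {x | 1 < x ∧ ∀ j, 1 ≤ j → j ≤ n → Pn a j x ∈ Set.Icc (0 : ℝ) 1}

/-- The conjugate of the (−β)-transformation under `x ↦ 1/(β+1) − x`, acting on `(0, 1]`. -/
noncomputable def flipT (β : ℝ) (x : ℝ) : ℝ := ⌊β * x⌋ + 1 - β * x

lemma flipT_pos (β x : ℝ) : 0 < flipT β x := by
  have := Int.lt_floor_add_one (β * x)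
  unfold flipT; linarith

lemma flipT_le_one (β x : ℝ) : flipT β x ≤ 1 := by
  have := Int.floor_le (β * x)
  unfold flipT; linarith

lemma flipT_iterate_mem (β : ℝ) (n : ℕ) : (flipT β)^[n] 1 ∈ Icc (0 : ℝ) 1 := by
  cases n with
  | zero => simp
  | succ n =>
    rw [Function.iterate_succ_apply']
    exact ⟨(flipT_pos _ _).le, flipT_le_one _ _⟩

lemma negBetaT_iterate {β : ℝ} (hβ : 1 < β) (n : ℕ) :
    (negBetaT β)^[n] (-β / (β + 1)) = 1 / (β + 1) - (flipT β)^[n] 1 := by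
  have h : β + 1 ≠ 0 := by linarith
  induction n with
  | zero => simp only [Function.iterate_zero, id]; field_simp; ring
  | succ n ih =>
    rw [Function.iterate_succ_apply', Function.iterate_succ_apply', ih]
    set y := (flipT β)^[n] 1
    have e : β / (β + 1) - β * (1 / (β + 1) - y) = β * y := by ring
    unfold negBetaT flipT
    rw [e]
    field_simp
    ring

lemma negBetaExp_eq {β : ℝ} (hβ : 1 < β) (n : ℕ) :
    negBetaExp β n = ⌊β * (flipT β)^[n] 1⌋ := by
  unfold negBetaExp negBetaDigit
  rw [negBetaT_iterate hβ]
  congr 1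
  ring

/-- Two points share the closed branches of the first `k` iterates of `flipT β`. -/
def SameBranches (β : ℝ) : ℕ → ℝ → ℝ → Prop
  | 0, _, _ => True
  | k + 1, x, y => ∃ d : ℤ, (d ≤ β * x ∧ β * x ≤ d + 1) ∧ (d ≤ β * y ∧ β * y ≤ d + 1) ∧
      SameBranches β k (d + 1 - β * x) (d + 1 - β * y)

lemma SameBranches.symm {β : ℝ} {k : ℕ} {x y : ℝ} (h : SameBranches β k x y) :
    SameBranches β k y x := by
  induction k generalizing x y with
  | zero => trivial
  | succ k ih =>
    obtain ⟨d, hx, hy, h⟩ := h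
    exact ⟨d, hy, hx, ih h⟩

lemma exists_sameBranches_near {β : ℝ} (hβ : 0 < β) (k : ℕ) (p : ℝ) :
    ∃ ε > 0, ∀ x, |x - p| ≤ ε → SameBranches β k x p := by
  induction k generalizing p with
  | zero => exact ⟨1, one_pos, fun _ _ => trivial⟩
  | succ k ih =>
    set d : ℤ := ⌊β * p⌋ with hd
    set c : ℤ := ⌈β * p⌉ - 1 with hc
    have hd1 : (d : ℝ) ≤ β * p := Int.floor_le _
    have hd2 : β * p < d + 1 := Int.lt_floor_add_one _
    have hc1 : (c : ℝ) < β * p := by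
      have := Int.ceil_lt_add_one (β * p)
      push_cast [hc]; linarith
    have hc2 : β * p ≤ c + 1 := by
      have := Int.le_ceil (β * p)
      push_cast [hc]; linarith
    obtain ⟨ε₁, h₁, H₁⟩ := ih (d + 1 - β * p)
    obtain ⟨ε₂, h₂, H₂⟩ := ih (c + 1 - β * p)
    refine ⟨min (min ε₁ ε₂) (min (d + 1 - β * p) (β * p - c)) / β,
      div_pos (lt_min (lt_min h₁ h₂) (lt_min (by linarith) (by linarith))) hβ, fun x hx => ?_⟩
    rw [le_div_iff₀ hβ, le_min_iff, le_min_iff, le_min_iff] at hx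
    obtain ⟨⟨a1, a2⟩, a3, a4⟩ := hx
    have habs : ∀ e : ℝ, |(e + 1 - β * x) - (e + 1 - β * p)| = |x - p| * β := by
      intro e
      rw [show (e + 1 - β * x) - (e + 1 - β * p) = -((x - p) * β) by ring, abs_neg, abs_mul,
        abs_of_pos hβ]
    rcases le_total p x with hpx | hpx
    · rw [abs_of_nonneg (by linarith)] at a3
      refine ⟨d, ⟨?_, ?_⟩, ⟨hd1, hd2.le⟩, H₁ _ (by rw [habs]; exact a1)⟩ <;> nlinarith
    · rw [abs_of_nonpos (by linarith)] at a4
      refine ⟨c, ⟨?_, ?_⟩, ⟨hc1.le, hc2⟩, H₂ _ (by rw [habs]; exact a2)⟩ <;> nlinarith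

lemma exists_sameBranches_split {β : ℝ} (hβ : 0 < β) (k : ℕ) :
    ∃ δ > 0, ∀ x y, x ≤ y → y - x ≤ δ →
      ∃ b ∈ Icc x y, SameBranches β k x b ∧ SameBranches β k b y := by
  induction k with
  | zero => exact ⟨1, one_pos, fun x y h _ => ⟨x, ⟨le_rfl, h⟩, trivial, trivial⟩⟩
  | succ k ih =>
    obtain ⟨δ, hδ, H⟩ := ih
    obtain ⟨ε₀, h₀, H₀⟩ := exists_sameBranches_near hβ k 0
    obtain ⟨ε₁, h₁, H₁⟩ := exists_sameBranches_near hβ k 1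
    refine ⟨min (min δ 1) (min ε₀ ε₁) / β,
      div_pos (lt_min (lt_min hδ one_pos) (lt_min h₀ h₁)) hβ, fun x y hxy hle => ?_⟩
    rw [le_div_iff₀ hβ, le_min_iff, le_min_iff, le_min_iff] at hle
    obtain ⟨⟨a1, a2⟩, a3, a4⟩ := hle
    set d : ℤ := ⌊β * x⌋ with hd
    have hd1 : (d : ℝ) ≤ β * x := Int.floor_le _
    have hd2 : β * x < d + 1 := Int.lt_floor_add_one _
    have hm : β * x ≤ β * y := by gcongr
    rcases le_or_gt (β * y) (d + 1) with hy | hy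
    · obtain ⟨b, ⟨hb1, hb2⟩, s1, s2⟩ := H (d + 1 - β * y) (d + 1 - β * x) (by linarith)
        (by linarith)
      have hb : β * ((d + 1 - b) / β) = d + 1 - b := by field_simp
      have hb' : (d : ℝ) + 1 - β * ((d + 1 - b) / β) = b := by rw [hb]; ring
      refine ⟨(d + 1 - b) / β, ⟨?_, ?_⟩, ⟨d, ⟨hd1, hd2.le⟩, ?_, ?_⟩, ⟨d, ?_, ⟨by linarith, hy⟩, ?_⟩⟩
      · rw [le_div_iff₀ hβ]; linarith
      · rw [div_le_iff₀ hβ]; linarith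
      · rw [hb]; constructor <;> linarith
      · rw [hb']; exact s2.symm
      · rw [hb]; constructor <;> linarith
      · rw [hb']; exact s1.symm
    · have hb : β * (((d : ℝ) + 1) / β) = d + 1 := by field_simp
      refine ⟨(d + 1) / β, ⟨?_, ?_⟩, ⟨d, ⟨hd1, hd2.le⟩, ?_, ?_⟩, ⟨d + 1, ?_, ⟨?_, ?_⟩, ?_⟩⟩
      · rw [le_div_iff₀ hβ]; linarith
      · rw [div_le_iff₀ hβ]; linarith
      · rw [hb]; constructor <;> linarith
      · rw [hb, sub_self]
        apply H₀
        rw [sub_zero, abs_of_nonneg (by linarith)]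
        linarith
      · rw [hb]; push_cast; constructor <;> linarith
      · push_cast; linarith
      · push_cast; linarith
      · rw [hb]; push_cast
        rw [add_sub_cancel_left]
        apply SameBranches.symm
        apply H₁
        rw [abs_of_nonpos (by linarith)]
        linarith

lemma SameBranches.exists_image {β γ : ℝ} (hβ : 0 < β) (hγ : 0 < γ) {F : ℝ → ℝ}
    (hF : ∀ (d : ℤ) (x y : ℝ), x ∈ Icc (0 : ℝ) 1 → y ∈ Icc (0 : ℝ) 1 →
      (d ≤ β * x ∧ β * x ≤ d + 1) → (d ≤ β * y ∧ β * y ≤ d + 1) →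
      |F x - F y| ≤ |F (d + 1 - β * x) - F (d + 1 - β * y)| / γ)
    {k : ℕ} {x y : ℝ} (hx : x ∈ Icc (0 : ℝ) 1) (hy : y ∈ Icc (0 : ℝ) 1)
    (h : SameBranches β k x y) :
    ∃ s ∈ Icc (0 : ℝ) 1, ∃ t ∈ Icc (0 : ℝ) 1, |s - t| = β ^ k * |x - y| ∧
      |F x - F y| ≤ |F s - F t| / γ ^ k := by
  induction k generalizing x y with
  | zero => exact ⟨x, hx, y, hy, by simp, by simp⟩
  | succ k ih =>
    obtain ⟨d, h1, h2, h⟩ := h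
    obtain ⟨s, hs, t, ht, e, hle⟩ := ih (x := d + 1 - β * x) (y := d + 1 - β * y)
      ⟨by linarith, by linarith⟩ ⟨by linarith, by linarith⟩ h
    refine ⟨s, hs, t, ht, ?_, ?_⟩
    · rw [e, show ((d : ℝ) + 1 - β * x) - (d + 1 - β * y) = -(β * (x - y)) by ring, abs_neg,
        abs_mul, abs_of_pos hβ]
      ring
    · calc |F x - F y| ≤ _ := hF d x y hx hy h1 h2
        _ ≤ (|F s - F t| / γ ^ k) / γ := by gcongr
        _ = _ := by rw [div_div, pow_succ]

lemma abs_sub_le_of_uniform_steps {F : ℝ → ℝ} {r c : ℝ} (hr : 0 < r)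
    (h : ∀ x ∈ Icc (0 : ℝ) 1, ∀ y ∈ Icc (0 : ℝ) 1, |x - y| ≤ r → |F x - F y| ≤ c) :
    |F 1 - F 0| ≤ (1 / r + 1) * c := by
  have hc : 0 ≤ c := (abs_nonneg _).trans (h 0 (by simp) 0 (by simp) (by simpa using hr.le))
  set N := ⌈1 / r⌉₊ with hN
  have hN1 : 1 / r ≤ N := Nat.le_ceil _
  have hN2 : (N : ℝ) < 1 / r + 1 := Nat.ceil_lt_add_one (by positivity)
  have hN0 : (0 : ℝ) < N := lt_of_lt_of_le (by positivity) hN1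
  have key : ∀ m : ℕ, m ≤ N → |F (m / N) - F 0| ≤ m * c := by
    intro m
    induction m with
    | zero => simp
    | succ m ih =>
      intro hm
      have hm' : ((m : ℝ) + 1) ≤ N := by exact_mod_cast hm
      have hs : |F ((m + 1 : ℕ) / N) - F (m / N)| ≤ c := by
        apply h
        · exact ⟨by positivity, by rw [div_le_one hN0]; exact_mod_cast hm⟩
        · exact ⟨by positivity, by rw [div_le_one hN0]; linarith⟩
        · rw [← sub_div, Nat.cast_succ, add_sub_cancel_left, abs_of_pos (by positivity)]
          rw [div_le_iff₀ hr] at hN1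
          rw [div_le_iff₀ hN0]; linarith
      have := abs_sub_le (F ((m + 1 : ℕ) / N)) (F (m / N)) (F 0)
      have := ih (by omega)
      push_cast at *
      linarith
  have := key N le_rfl
  rw [div_self hN0.ne'] at this
  exact this.trans (by gcongr)

/-- A function contracted by `γ` along the branches of slope `-β` with `β < γ` cannot separate
the endpoints of the unit interval. -/
lemma eq_of_branch_contraction {β γ : ℝ} (hβ : 1 < β) (hγ : β < γ) {F : ℝ → ℝ}
    (hF01 : ∀ x ∈ Icc (0 : ℝ) 1, F x ∈ Icc (0 : ℝ) 1)
    (hF : ∀ (d : ℤ) (x y : ℝ), x ∈ Icc (0 : ℝ) 1 → y ∈ Icc (0 : ℝ) 1 →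
      (d ≤ β * x ∧ β * x ≤ d + 1) → (d ≤ β * y ∧ β * y ≤ d + 1) →
      |F x - F y| ≤ |F (d + 1 - β * x) - F (d + 1 - β * y)| / γ) :
    F 1 = F 0 := by
  have hβ0 : 0 < β := by linarith
  have hγ0 : 0 < γ := by linarith
  obtain ⟨k, hk⟩ : ∃ k : ℕ, (β / γ) ^ k < 1 / 4 :=
    exists_pow_lt_of_lt_one (by norm_num) ((div_lt_one hγ0).2 hγ)
  obtain ⟨δ, hδ, H⟩ := exists_sameBranches_split hβ0 k
  have hone : 1 ≤ β ^ k := one_le_pow₀ hβ.le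
  have osc : ∀ j : ℕ, ∀ x ∈ Icc (0 : ℝ) 1, ∀ y ∈ Icc (0 : ℝ) 1, |x - y| ≤ δ / (β ^ k) ^ j →
      |F x - F y| ≤ (2 / γ ^ k) ^ j := by
    intro j
    induction j with
    | zero =>
      intro x hx y hy _
      have := hF01 x hx
      have := hF01 y hy
      simp only [mem_Icc, pow_zero] at *
      rw [abs_le]; constructor <;> linarith
    | succ j ih =>
      intro x hx y hy hxy
      wlog hle : x ≤ y generalizing x y
      · rw [abs_sub_comm] at hxy ⊢
        exact this y hy x hx hxy (by linarith)
      have hxy' : |x - y| ≤ δ := hxy.trans (div_le_self hδ.le (one_le_pow₀ hone))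
      have habs : |x - y| = y - x := by rw [abs_of_nonpos (by linarith)]; ring
      obtain ⟨b, ⟨hb1, hb2⟩, s1, s2⟩ := H x y hle (by linarith)
      have hb : b ∈ Icc (0 : ℝ) 1 := ⟨hx.1.trans hb1, hb2.trans hy.2⟩
      have piece : ∀ u ∈ Icc (0 : ℝ) 1, ∀ v ∈ Icc (0 : ℝ) 1, |u - v| ≤ |x - y| →
          SameBranches β k u v → |F u - F v| ≤ (2 / γ ^ k) ^ j / γ ^ k := by
        intro u hu v hv huv hs
        obtain ⟨s, hs, t, ht, e, hFle⟩ := hs.exists_image hβ0 hγ0 hF hu hv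
        refine hFle.trans ?_
        gcongr
        apply ih s hs t ht
        rw [e]
        calc β ^ k * |u - v| ≤ β ^ k * (δ / (β ^ k) ^ (j + 1)) := by gcongr; exact huv.trans hxy
          _ = δ / (β ^ k) ^ j := by rw [pow_succ]; field_simp
      have p1 := piece x hx b hb (by rw [habs, abs_of_nonpos] <;> linarith) s1
      have p2 := piece b hb y hy (by rw [habs, abs_of_nonpos] <;> linarith) s2
      calc |F x - F y| ≤ |F x - F b| + |F b - F y| := abs_sub_le _ _ _
        _ ≤ (2 / γ ^ k) ^ j / γ ^ k + (2 / γ ^ k) ^ j / γ ^ k := add_le_add p1 p2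
        _ = (2 / γ ^ k) ^ (j + 1) := by ring
  have bound : ∀ j : ℕ, |F 1 - F 0| ≤ (1 / δ + 1) * (1 / 2) ^ j := by
    intro j
    have h1 := abs_sub_le_of_uniform_steps (r := δ / (β ^ k) ^ j) (by positivity) (osc j)
    have hq : β ^ k * (2 / γ ^ k) ≤ 1 / 2 := by
      rw [div_pow] at hk
      calc β ^ k * (2 / γ ^ k) = 2 * (β ^ k / γ ^ k) := by ring
        _ ≤ 1 / 2 := by linarith
    have hone' : 1 ≤ (β ^ k) ^ j := one_le_pow₀ hone
    calc |F 1 - F 0| ≤ _ := h1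
      _ ≤ ((β ^ k) ^ j * (1 / δ) + (β ^ k) ^ j) * (2 / γ ^ k) ^ j := by
        gcongr
        rw [one_div_div]; apply le_of_eq; ring
      _ = (1 / δ + 1) * (β ^ k * (2 / γ ^ k)) ^ j := by rw [mul_pow]; ring
      _ ≤ _ := by gcongr
  have lim : Tendsto (fun j : ℕ => (1 / δ + 1) * (1 / 2 : ℝ) ^ j) atTop (nhds 0) := by
    simpa using (tendsto_pow_atTop_nhds_zero_of_lt_one (r := (1 / 2 : ℝ)) (by norm_num)
      (by norm_num)).const_mul (1 / δ + 1)
  have := ge_of_tendsto' lim bound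
  exact sub_eq_zero.1 (abs_nonpos_iff.1 this)

/-- The iterates, from zero, of the contraction whose fixed point reads digits in base `-β`
and evaluates them in base `-γ`. -/
noncomputable def transferIter (β γ : ℝ) : ℕ → ℝ → ℝ
  | 0, _ => 0
  | n + 1, x => min 1 ((⌊β * x⌋ + 1 - transferIter β γ n (flipT β x)) / γ)

lemma transferIter_mem {β γ : ℝ} (hβ : 0 < β) (hγ : 0 < γ) (n : ℕ) {x : ℝ} (hx : 0 ≤ x) :
    transferIter β γ n x ∈ Icc (0 : ℝ) 1 := by
  induction n generalizing x with
  | zero => simp [transferIter]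
  | succ n ih =>
    have h := ih (flipT_pos β x).le
    have hd : (0 : ℝ) ≤ ⌊β * x⌋ := by exact_mod_cast Int.floor_nonneg.2 (by positivity)
    refine ⟨le_min zero_le_one (div_nonneg ?_ hγ.le), min_le_left _ _⟩
    linarith [h.2]

lemma abs_min_one_sub_le {γ : ℝ} (hγ : 0 < γ) (c u v : ℝ) :
    |min 1 ((c - u) / γ) - min 1 ((c - v) / γ)| ≤ |u - v| / γ := by
  refine (abs_min_sub_min_le_max _ _ _ _).trans (max_le (by simp; positivity) ?_)
  rw [← sub_div, abs_div, abs_of_pos hγ, show c - u - (c - v) = -(u - v) by ring, abs_neg]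

lemma exists_transfer {β γ : ℝ} (hβ : 0 < β) (hγ : 1 < γ) :
    ∃ F : ℝ → ℝ, (∀ x, 0 ≤ x → F x ∈ Icc (0 : ℝ) 1) ∧
      ∀ x, 0 ≤ x → F x = min 1 ((⌊β * x⌋ + 1 - F (flipT β x)) / γ) := by
  have hγ0 : 0 < γ := by linarith
  have step : ∀ n x, 0 ≤ x →
      |transferIter β γ n x - transferIter β γ (n + 1) x| ≤ 1 * (1 / γ) ^ n := by
    intro n
    induction n with
    | zero =>
      intro x hx
      have := transferIter_mem hβ hγ0 1 hx
      simp only [transferIter, zero_sub, abs_neg, pow_zero, mul_one] at this ⊢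
      rw [abs_of_nonneg this.1]; exact this.2
    | succ n ih =>
      intro x _
      refine (abs_min_one_sub_le hγ0 _ _ _).trans ?_
      have := ih (flipT β x) (flipT_pos β x).le
      calc _ ≤ 1 * (1 / γ) ^ n / γ := by gcongr
        _ = _ := by ring
  have conv : ∀ x, 0 ≤ x → ∃ l, Tendsto (fun n => transferIter β γ n x) atTop (nhds l) := by
    intro x hx
    apply cauchySeq_tendsto_of_complete
    exact cauchySeq_of_le_geometric (1 / γ) 1 ((div_lt_one hγ0).2 hγ) fun n => step n x hx
  choose! F hF using conv
  refine ⟨F, fun x hx => isClosed_Icc.mem_of_tendsto (hF x hx)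
    (Eventually.of_forall fun n => transferIter_mem hβ hγ0 n hx), fun x hx => ?_⟩
  have h1 := (tendsto_add_atTop_iff_nat 1).2 (hF x hx)
  have h2 := hF (flipT β x) (flipT_pos β x).le
  exact tendsto_nhds_unique h1
    (tendsto_const_nhds.min ((tendsto_const_nhds.sub h2).div_const γ))

lemma transfer_branch {β γ : ℝ} {F : ℝ → ℝ}
    (hF : ∀ x, 0 ≤ x → F x = min 1 ((⌊β * x⌋ + 1 - F (flipT β x)) / γ)) (h1 : F 1 = 1)
    {d : ℤ} {x : ℝ} (hx : 0 ≤ x) (hd : d ≤ β * x ∧ β * x ≤ d + 1) :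
    F x = min 1 ((d + 1 - F (d + 1 - β * x)) / γ) := by
  have h0 : F 0 = 0 := by
    rw [hF 0 le_rfl]
    simp [flipT, h1]
  rcases hd.2.lt_or_eq with h | h
  · have e : ⌊β * x⌋ = d := Int.floor_eq_iff.2 ⟨hd.1, h⟩
    rw [hF x hx, flipT, e]
  · have e : ⌊β * x⌋ = d + 1 := by rw [h]; exact_mod_cast Int.floor_intCast (d + 1)
    rw [hF x hx, flipT, e, h]
    push_cast
    rw [add_sub_cancel_left, h1, sub_self, h0]
    congr 2; ring

lemma transfer_one {β γ : ℝ} (hγ : 1 < γ) {F : ℝ → ℝ}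
    (hF01 : ∀ x, 0 ≤ x → F x ∈ Icc (0 : ℝ) 1)
    (hF : ∀ x, 0 ≤ x → F x = min 1 ((⌊β * x⌋ + 1 - F (flipT β x)) / γ))
    (hlt : ¬ AltLt (fun n => ⌊β * (flipT β)^[n] 1⌋) (fun n => ⌊γ * (flipT γ)^[n] 1⌋)) :
    F 1 = 1 := by
  have hγ0 : 0 < γ := by linarith
  by_contra hne
  have hC : 0 < 1 - F 1 := by
    have := (hF01 1 zero_le_one).2
    rcases this.lt_or_eq with h | h
    · linarith
    · exact absurd h hne
  set y : ℕ → ℝ := fun n => (flipT β)^[n] 1 with hy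
  set z : ℕ → ℝ := fun n => (flipT γ)^[n] 1 with hz
  have hy01 : ∀ n, y n ∈ Icc (0 : ℝ) 1 := flipT_iterate_mem β
  have hz01 : ∀ n, z n ∈ Icc (0 : ℝ) 1 := flipT_iterate_mem γ
  have hys : ∀ n, y (n + 1) = flipT β (y n) := fun n => Function.iterate_succ_apply' _ _ _
  have hzs : ∀ n, z (n + 1) = ⌊γ * z n⌋ + 1 - γ * z n :=
    fun n => Function.iterate_succ_apply' _ _ _
  have hFy : ∀ n, F (y n) = min 1 ((⌊β * y n⌋ + 1 - F (y (n + 1))) / γ) := by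
    intro n; rw [hys]; exact hF _ (hy01 n).1
  have hFle : ∀ n, γ * F (y n) ≤ ⌊β * y n⌋ + 1 - F (y (n + 1)) := by
    intro n
    have : F (y n) ≤ _ := (hFy n).trans_le (min_le_right _ _)
    rw [le_div_iff₀ hγ0] at this; linarith
  have hFge : ∀ n, F (y n) < 1 → ⌊β * y n⌋ + 1 - F (y (n + 1)) ≤ γ * F (y n) := by
    intro n h
    have h2 := hFy n
    rcases min_choice 1 ((⌊β * y n⌋ + 1 - F (y (n + 1))) / γ) with e | e
    · rw [e] at h2; linarith
    · rw [e, eq_div_iff hγ0.ne'] at h2; linarith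
  have grow : ∀ n, (∀ i < n, ⌊β * y i⌋ = ⌊γ * z i⌋) →
      (Even n → γ ^ n * (1 - F 1) ≤ z n - F (y n)) ∧
      (¬ Even n → γ ^ n * (1 - F 1) ≤ F (y n) - z n) := by
    intro n
    induction n with
    | zero => intro _; simp [hy, hz]
    | succ n ih =>
      intro hi
      obtain ⟨i1, i2⟩ := ih fun i h => hi i (by omega)
      have e : (⌊β * y n⌋ : ℝ) = ⌊γ * z n⌋ := by exact_mod_cast hi n (by omega)
      have hpos : 0 < γ ^ n * (1 - F 1) := by positivity
      have hz1 := hzs n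
      rw [Nat.even_add_one, not_not]
      constructor
      · intro hn
        have h1 := mul_le_mul_of_nonneg_left (i2 hn) hγ0.le
        have h2 := hFle n
        rw [pow_succ]; linarith
      · intro hn
        have h1 := mul_le_mul_of_nonneg_left (i1 hn) hγ0.le
        have h2 := hFge n (by linarith [i1 hn, (hz01 n).2])
        rw [pow_succ]; linarith
  by_cases heq : ∀ n, ⌊β * y n⌋ = ⌊γ * z n⌋
  · obtain ⟨n, hn⟩ := pow_unbounded_of_one_lt (1 / (1 - F 1)) hγ
    rw [div_lt_iff₀ hC] at hn
    obtain ⟨g1, g2⟩ := grow n fun i _ => heq i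
    have := hF01 _ (hy01 n).1
    have := hz01 n
    simp only [mem_Icc] at *
    by_cases he : Even n
    · linarith [g1 he]
    · linarith [g2 he]
  · push Not at heq
    classical
    set k := Nat.find heq with hk
    have hkne : ⌊β * y k⌋ ≠ ⌊γ * z k⌋ := Nat.find_spec heq
    have hmin : ∀ i < k, ⌊β * y i⌋ = ⌊γ * z i⌋ := fun i hi => by
      simpa using Nat.find_min heq hi
    obtain ⟨g1, g2⟩ := grow k hmin
    have hpos : 0 < γ ^ k * (1 - F 1) := by positivity
    have hF1 := hF01 _ (hy01 (k + 1)).1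
    have f1 := Int.floor_le (γ * z k)
    have f2 := Int.lt_floor_add_one (γ * z k)
    by_cases he : Even k
    · have hlt' : ⌊γ * z k⌋ + 1 ≤ ⌊β * y k⌋ := by
        by_contra hcon
        exact hlt ⟨k, hmin, by rw [if_pos he]; change ⌊β * y k⌋ < ⌊γ * z k⌋; omega⟩
      have hlt'' : (⌊γ * z k⌋ : ℝ) + 1 ≤ ⌊β * y k⌋ := by exact_mod_cast hlt'
      have h1 := g1 he
      have h2 := hFge k (by linarith [(hz01 k).2])
      have h3 : γ * F (y k) < γ * z k := by gcongr; linarith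
      linarith [hF1.2]
    · have hlt' : ⌊β * y k⌋ + 1 ≤ ⌊γ * z k⌋ := by
        by_contra hcon
        exact hlt ⟨k, hmin, by rw [if_neg he]; change ⌊γ * z k⌋ < ⌊β * y k⌋; omega⟩
      have hlt'' : (⌊β * y k⌋ : ℝ) + 1 ≤ ⌊γ * z k⌋ := by exact_mod_cast hlt'
      have h1 := g2 he
      have h2 := hFle k
      have h3 : γ * z k < γ * F (y k) := by gcongr; linarith
      linarith [hF1.1]

lemma altLt_negBetaExp {β γ : ℝ} (hβ : 1 < β) (hγ : β < γ) :
    AltLt (negBetaExp β) (negBetaExp γ) := by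
  have hβ0 : 0 < β := by linarith
  have hγ1 : 1 < γ := by linarith
  have hγ0 : 0 < γ := by linarith
  by_contra hlt
  rw [funext (negBetaExp_eq hβ), funext (negBetaExp_eq hγ1)] at hlt
  obtain ⟨F, hF01, hF⟩ := exists_transfer hβ0 hγ1
  have h1 := transfer_one hγ1 hF01 hF hlt
  have h0 : F 0 = 0 := by
    rw [hF 0 le_rfl]
    simp [flipT, h1]
  have := eq_of_branch_contraction hβ hγ (fun x hx => hF01 x hx.1) fun d x y hx hy hdx hdy => by
    rw [transfer_branch hF h1 hx.1 hdx, transfer_branch hF h1 hy.1 hdy]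
    exact abs_min_one_sub_le hγ0 _ _ _
  rw [h0, h1] at this
  exact one_ne_zero this

lemma AltLt.asymm {x y : ℕ → ℤ} (h : AltLt x y) : ¬ AltLt y x := by
  obtain ⟨k, hk, hk'⟩ := h
  rintro ⟨l, hl, hl'⟩
  rcases lt_trichotomy k l with h | h | h
  · have := hl k h
    split_ifs at hk' <;> omega
  · subst h
    split_ifs at hk' hl' <;> omega
  · have := hk l h
    split_ifs at hl' <;> omega

/-- β < β' iff the (−β)-expansion of −β/(β+1) is <_alt the
(−β')-expansion of −β'/(β'+1). -/
theorem stmt_0 (β β' : ℝ) (hβ : 1 < β) (hβ' : 1 < β') (a a' : ℕ → ℤ)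
    (ha : ∀ n, a n = negBetaExp β n) (ha' : ∀ n, a' n = negBetaExp β' n) :
    β < β' ↔ AltLt a a' := by
  obtain rfl : a = negBetaExp β := funext ha
  obtain rfl : a' = negBetaExp β' := funext ha'
  refine ⟨altLt_negBetaExp hβ, fun h => ?_⟩
  rcases lt_trichotomy β β' with hlt | rfl | hlt
  · exact hlt
  · exact absurd h h.asymm
  · exact absurd (altLt_negBetaExp hβ' hlt) h.asymm
end

section
/- Let a_1 a_2 ⋯ be a sequence of non-negative integers satisfying (G) and (L). Then there exists a unique β > 1 such that Σ_{j≥1} a_j/(−β)^j = −β/(β+1) and, for every k ≥ 1, Σ_{j≥1} a_{k+j}/(−β)^j ∈ [−β/(β+1), 1/(β+1)] (closed interval). -/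
open Filter Set

namespace NegBeta

/-- The left-hand constant of the branch with digit `d`, for branch weights `τ`. -/
noncomputable def branchTop (τ : ℕ → ℝ) (d : ℕ) : ℝ := 1 - ∑ e ∈ Finset.range d, τ e

lemma branchTop_zero (τ : ℕ → ℝ) : branchTop τ 0 = 1 := by simp [branchTop]

lemma branchTop_succ (τ : ℕ → ℝ) (d : ℕ) : branchTop τ (d + 1) = branchTop τ d - τ d := by
  simp only [branchTop, Finset.sum_range_succ]; ring

lemma branchTop_antitone {τ : ℕ → ℝ} (hτ : ∀ d, 0 ≤ τ d) : Antitone (branchTop τ) :=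
  antitone_nat_of_succ_le fun d => by rw [branchTop_succ]; linarith [hτ d]

/-- `Z` is a nonnegative orbit of the piecewise decreasing map with branch weights `τ`,
following the digits `b`. -/
structure IsOrbit (τ : ℕ → ℝ) (b : ℕ → ℕ) (Z : ℕ → ℝ) : Prop where
  nonneg : ∀ i, 0 ≤ Z i
  step : ∀ i, Z i = branchTop τ (b i) - τ (b i) * Z (i + 1)

lemma IsOrbit.le_one {τ : ℕ → ℝ} {b : ℕ → ℕ} {Z : ℕ → ℝ} (h : IsOrbit τ b Z)
    (hτ : ∀ d, 0 ≤ τ d) (i : ℕ) : Z i ≤ 1 := by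
  rw [h.step i]
  have h1 := branchTop_antitone hτ (Nat.zero_le (b i))
  rw [branchTop_zero] at h1
  have h2 := mul_nonneg (hτ (b i)) (h.nonneg (i + 1))
  linarith

/-- The product of the weights of the first `i` digits. -/
noncomputable def wordWeight (τ : ℕ → ℝ) (b : ℕ → ℕ) (i : ℕ) : ℝ := ∏ j ∈ Finset.range i, τ (b j)

lemma wordWeight_succ (τ : ℕ → ℝ) (b : ℕ → ℕ) (i : ℕ) :
    wordWeight τ b (i + 1) = wordWeight τ b i * τ (b i) := Finset.prod_range_succ _ _

lemma wordWeight_zero (τ : ℕ → ℝ) (b : ℕ → ℕ) : wordWeight τ b 0 = 1 := Finset.prod_range_zero _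

lemma wordWeight_nonneg {τ : ℕ → ℝ} (hτ : ∀ d, 0 ≤ τ d) (b : ℕ → ℕ) (i : ℕ) :
    0 ≤ wordWeight τ b i := Finset.prod_nonneg fun _ _ => hτ _

lemma wordWeight_le_pow {τ : ℕ → ℝ} {c : ℝ} (hτ : ∀ d, 0 ≤ τ d) (hc : ∀ d, τ d ≤ c)
    (b : ℕ → ℕ) (i : ℕ) : wordWeight τ b i ≤ c ^ i := by
  calc wordWeight τ b i ≤ ∏ _j ∈ Finset.range i, c :=
        Finset.prod_le_prod (fun _ _ => hτ _) (fun _ _ => hc _)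
    _ = c ^ i := by simp

/-- Distribution function of the signed masses `g i` placed at the points `Z i`. -/
noncomputable def stepSum (g Z : ℕ → ℝ) (w : ℝ) : ℝ := ∑' i, g i * if Z i ≤ w then 1 else 0

lemma summable_mul_ite {g : ℕ → ℝ} (hg : Summable g) (p : ℕ → Prop) [DecidablePred p] :
    Summable fun i => g i * if p i then (1 : ℝ) else 0 := by
  refine Summable.of_norm_bounded hg.norm fun i => ?_
  rw [norm_mul]
  refine mul_le_of_le_one_right (norm_nonneg _) ?_
  split_ifs <;> simp

lemma monotone_stepSum {g : ℕ → ℝ} (hg : Summable g) (h0 : ∀ i, 0 ≤ g i) (Z : ℕ → ℝ) :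
    Monotone (stepSum g Z) := by
  intro v w hvw
  refine Summable.tsum_le_tsum (fun i => ?_) (summable_mul_ite hg _) (summable_mul_ite hg _)
  refine mul_le_mul_of_nonneg_left ?_ (h0 i)
  by_cases h : Z i ≤ v
  · simp [h, h.trans hvw]
  · rw [if_neg h]; split_ifs <;> simp

lemma intervalIntegrable_stepSum {g : ℕ → ℝ} (hg : Summable g) (Z : ℕ → ℝ) (u v : ℝ) :
    IntervalIntegrable (stepSum g Z) MeasureTheory.volume u v := by
  have h1 : Summable fun i => |g i| + g i := hg.abs.add hg
  have key : stepSum g Z = fun w => stepSum (fun i => |g i| + g i) Z w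
      - stepSum (fun i => |g i|) Z w := by
    funext w
    simp only [stepSum]
    rw [← Summable.tsum_sub (summable_mul_ite h1 _) (summable_mul_ite hg.abs _)]
    congr 1; funext i; ring
  rw [key]
  exact ((monotone_stepSum h1 (fun i => by linarith [neg_abs_le (g i)]) Z).intervalIntegrable).sub
    ((monotone_stepSum hg.abs (fun i => abs_nonneg _) Z).intervalIntegrable)

lemma stepSum_of_lt {g Z : ℕ → ℝ} {w : ℝ} (h : ∀ i, w < Z i) : stepSum g Z w = 0 := by
  simp [stepSum, fun i => not_le.mpr (h i)]

lemma tendsto_stepSum {g : ℕ → ℝ} (hg : Summable g) (Z : ℕ → ℝ) (w : ℝ) :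
    Tendsto (stepSum g Z) (nhdsWithin w (Ioi w)) (nhds (stepSum g Z w)) := by
  refine tendsto_tsum_of_dominated_convergence hg.norm (fun i => ?_)
    (Eventually.of_forall fun v i => ?_)
  · refine Tendsto.const_mul _ (tendsto_const_nhds.congr' ?_)
    by_cases h : Z i ≤ w
    · filter_upwards [self_mem_nhdsWithin] with v hv
      rw [if_pos h, if_pos (h.trans (le_of_lt hv))]
    · filter_upwards [Ioo_mem_nhdsGT (not_le.mp h)] with v hv
      rw [if_neg h, if_neg (not_le.mpr hv.2)]
  · rw [norm_mul]
    refine mul_le_of_le_one_right (norm_nonneg _) ?_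
    split_ifs <;> simp

/-- The signed weights of the finite words read along `b`. -/
noncomputable def signedWeight (τ : ℕ → ℝ) (b : ℕ → ℕ) (i : ℕ) : ℝ := (-1) ^ i * wordWeight τ b i

lemma signedWeight_succ (τ : ℕ → ℝ) (b : ℕ → ℕ) (i : ℕ) :
    signedWeight τ b (i + 1) = -(signedWeight τ b i * τ (b i)) := by
  rw [signedWeight, wordWeight_succ, signedWeight]; ring

lemma summable_signedWeight {τ : ℕ → ℝ} {c : ℝ} (hτ : ∀ d, 0 ≤ τ d) (hc : ∀ d, τ d ≤ c)
    (hc1 : c < 1) (b : ℕ → ℕ) : Summable (signedWeight τ b) := by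
  refine Summable.of_norm_bounded
    (summable_geometric_of_lt_one ((hτ 0).trans (hc 0)) hc1) fun i => ?_
  rw [signedWeight, norm_mul, norm_pow, norm_neg, norm_one, one_pow, one_mul,
    Real.norm_of_nonneg (wordWeight_nonneg hτ b i)]
  exact wordWeight_le_pow hτ hc b i

lemma sum_mul_ite_branch (σ : ℕ → ℝ) {τ : ℕ → ℝ} (hτ : ∀ d, 0 < τ d) {b : ℕ → ℕ} {Z : ℕ → ℝ}
    (h : IsOrbit τ b Z) {n : ℕ} (hb : ∀ i, b i < n) {w : ℝ} (hw0 : 0 < w) (hw1 : w < 1) (i : ℕ)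
    (hw : w ≠ Z (i + 1)) :
    ∑ d ∈ Finset.range n, σ d * (if Z i ≤ branchTop τ d - τ d * w then (1 : ℝ) else 0) =
      1 - branchTop σ (b i) + σ (b i) * (1 - if Z (i + 1) ≤ w then 1 else 0) := by
  have hτ' : ∀ d, 0 ≤ τ d := fun d => (hτ d).le
  have hterm : ∀ d ∈ Finset.range n,
      σ d * (if Z i ≤ branchTop τ d - τ d * w then (1 : ℝ) else 0) =
        (if d < b i then σ d else 0) +
          if d = b i then σ (b i) * (1 - if Z (i + 1) ≤ w then 1 else 0) else 0 := by
    intro d _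
    have hZ := h.step i
    have hb1 := mul_nonneg (hτ' (b i)) (h.nonneg (i + 1))
    have hb2 := mul_le_mul_of_nonneg_left (h.le_one hτ' (i + 1)) (hτ' (b i))
    have hd1 : 0 < τ d * w := mul_pos (hτ d) hw0
    have hd2 : τ d * w < τ d := mul_lt_of_lt_one_right (hτ d) hw1
    rcases lt_trichotomy d (b i) with hd | hd | hd
    · have := branchTop_antitone hτ' (Nat.succ_le_of_lt hd)
      rw [Nat.succ_eq_add_one, branchTop_succ] at this
      rw [if_pos (by linarith), if_pos hd, if_neg hd.ne]; ring
    · subst hd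
      rw [if_neg (lt_irrefl _), if_pos rfl, zero_add]
      congr 1
      rcases lt_or_gt_of_ne hw with hlt | hlt
      · have := mul_lt_mul_of_pos_left hlt (hτ (b i))
        rw [if_pos (by linarith), if_neg (not_le.mpr hlt)]; ring
      · have := mul_lt_mul_of_pos_left hlt (hτ (b i))
        rw [if_neg (by linarith), if_pos hlt.le]; ring
    · have := branchTop_antitone hτ' (Nat.succ_le_of_lt hd)
      rw [Nat.succ_eq_add_one, branchTop_succ] at this
      rw [if_neg (by linarith), if_neg (not_lt.mpr hd.le), if_neg hd.ne']; ring
  rw [Finset.sum_congr rfl hterm, Finset.sum_add_distrib, Finset.sum_ite_eq' (Finset.range n),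
    if_pos (Finset.mem_range.mpr (hb i)), ← Finset.sum_filter]
  congr 1
  have : (Finset.range n).filter (fun d => d < b i) = Finset.range (b i) := by
    ext d; simp only [Finset.mem_filter, Finset.mem_range]
    exact ⟨fun h => h.2, fun h => ⟨h.trans (hb i), h⟩⟩
  rw [this, branchTop]; ring

lemma stepSum_eq_sum_branch {σ τ : ℕ → ℝ} {c : ℝ} (hσ : ∀ d, 0 ≤ σ d) (hσc : ∀ d, σ d ≤ c)
    (hc : c < 1) (hτ : ∀ d, 0 < τ d) {b : ℕ → ℕ} {Y Z : ℕ → ℝ} (hY : IsOrbit σ b Y)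
    (hZ : IsOrbit τ b Z) (hY0 : Y 0 = 0) (hZ0 : Z 0 = 0) {n : ℕ} (hb : ∀ i, b i < n) {w : ℝ}
    (hw0 : 0 < w) (hw1 : w < 1) (hw : ∀ i, w ≠ Z i) :
    stepSum (signedWeight σ b) Z w =
      ∑ d ∈ Finset.range n, σ d * stepSum (signedWeight σ b) Z (branchTop τ d - τ d * w) := by
  set g := signedWeight σ b with hg
  have hsum : Summable g := summable_signedWeight hσ hσc hc b
  have h1 : Summable fun i => g i * (1 - Y i) := by
    refine Summable.of_norm_bounded hsum.norm fun i => ?_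
    rw [norm_mul]
    refine mul_le_of_le_one_right (norm_nonneg _) ?_
    rw [Real.norm_eq_abs, abs_le]
    constructor <;> linarith [hY.nonneg i, hY.le_one hσ i]
  have h2 : Summable fun i => g i * if Z i ≤ w then (1 : ℝ) else 0 := summable_mul_ite hsum _
  have h1' := (summable_nat_add_iff 1).mpr h1
  have h2' := (summable_nat_add_iff 1).mpr h2
  have hg0 : g 0 = 1 := by simp [hg, signedWeight, wordWeight_zero]
  have hR : ∑ d ∈ Finset.range n, σ d * stepSum g Z (branchTop τ d - τ d * w) =
      ∑' i, ((g i * (1 - Y i) - g (i + 1) * (1 - Y (i + 1))) +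
        g (i + 1) * if Z (i + 1) ≤ w then (1 : ℝ) else 0) := by
    simp only [stepSum, ← tsum_mul_left]
    rw [← Summable.tsum_finsetSum fun d _ => (summable_mul_ite hsum _).mul_left _]
    congr 1; funext i
    have := sum_mul_ite_branch σ hτ hZ hb hw0 hw1 i (hw (i + 1))
    calc _ = g i * ∑ d ∈ Finset.range n,
          σ d * (if Z i ≤ branchTop τ d - τ d * w then (1 : ℝ) else 0) := by
          rw [Finset.mul_sum]; refine Finset.sum_congr rfl fun d _ => by ring
      _ = _ := by
          rw [this, hg, signedWeight_succ, hY.step i]; ring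
  rw [hR, Summable.tsum_add (h1.sub h1') h2', Summable.tsum_sub h1 h1', h1.tsum_eq_zero_add,
    stepSum, h2.tsum_eq_zero_add, hY0, hZ0, hg0, if_pos hw0.le]
  ring

/-- Two orbits with the same digits, both starting at `0`, for two families of weights one of which
is uniformly smaller than the other: the signed weights of the returns to `0` cancel. -/
lemma tsum_return_eq_zero {σ τ : ℕ → ℝ} {c : ℝ} (hσ : ∀ d, 0 ≤ σ d) (hστ : ∀ d, σ d ≤ c * τ d)
    (hc : c < 1) (hτ : ∀ d, 0 < τ d) (hτ1 : ∀ d, τ d ≤ 1) {b : ℕ → ℕ} {Y Z : ℕ → ℝ}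
    (hY : IsOrbit σ b Y) (hZ : IsOrbit τ b Z) (hY0 : Y 0 = 0) (hZ0 : Z 0 = 0) {n : ℕ}
    (hb : ∀ i, b i < n) : stepSum (signedWeight σ b) Z 0 = 0 := by
  have hc0 : 0 ≤ c := by
    by_contra! h
    linarith [hσ 0, hστ 0, mul_neg_of_neg_of_pos h (hτ 0)]
  have hσc : ∀ d, σ d ≤ c := fun d => (hστ d).trans (mul_le_of_le_one_right hc0 (hτ1 d))
  set F := stepSum (signedWeight σ b) Z with hF
  have hsum : Summable (signedWeight σ b) := summable_signedWeight hσ hσc hc b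
  have hint : ∀ u v, IntervalIntegrable (fun w => |F w|) MeasureTheory.volume u v := fun u v =>
    (intervalIntegrable_stepSum hsum Z u v).abs
  have hneg : ∀ w < 0, F w = 0 := fun w hw => stepSum_of_lt fun i => hw.trans_le (hZ.nonneg i)
  have hint' : ∀ d, IntervalIntegrable (fun w => σ d * |F (branchTop τ d - τ d * w)|)
      MeasureTheory.volume 0 1 := by
    intro d
    refine IntervalIntegrable.const_mul ?_ _
    have := (hint (branchTop τ d) (branchTop τ d - τ d))
    have h2 := (this.comp_sub_left (branchTop τ d)).comp_mul_left (c := τ d)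
    simpa [(hτ d).ne'] using h2
  have hle : ∫ w in (0 : ℝ)..1, |F w| ≤
      ∫ w in (0 : ℝ)..1, ∑ d ∈ Finset.range n, σ d * |F (branchTop τ d - τ d * w)| := by
    refine intervalIntegral.integral_mono_ae_restrict zero_le_one (hint 0 1)
      (by simpa only [Finset.sum_fn] using
        IntervalIntegrable.sum (Finset.range n) fun d _ => hint' d) ?_
    have hcount : (Set.range Z ∪ {0, 1}).Countable :=
      (Set.countable_range Z).union (by simp)
    have hae : ∀ᵐ w ∂(MeasureTheory.volume : MeasureTheory.Measure ℝ), w ∉ Set.range Z ∪ {0, 1} :=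
      MeasureTheory.measure_eq_zero_iff_ae_notMem.mp (hcount.measure_zero _)
    filter_upwards [MeasureTheory.ae_restrict_of_ae hae,
      MeasureTheory.ae_restrict_mem measurableSet_Icc] with w hw hwI
    simp only [Set.mem_union, Set.mem_range, Set.mem_insert_iff, Set.mem_singleton_iff,
      not_or, not_exists] at hw
    rw [hF, stepSum_eq_sum_branch hσ hσc hc hτ hY hZ hY0 hZ0 hb
      (lt_of_le_of_ne hwI.1 (Ne.symm hw.2.1)) (lt_of_le_of_ne hwI.2 hw.2.2)
      (fun i => Ne.symm (hw.1 i))]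
    refine (Finset.abs_sum_le_sum_abs _ _).trans (Finset.sum_le_sum fun d _ => ?_)
    rw [abs_mul, abs_of_nonneg (hσ d)]
  have hbranch : ∀ d, ∫ w in (0 : ℝ)..1, σ d * |F (branchTop τ d - τ d * w)| ≤
      c * ∫ w in branchTop τ (d + 1)..branchTop τ d, |F w| := by
    intro d
    have hnn : 0 ≤ ∫ w in branchTop τ (d + 1)..branchTop τ d, |F w| :=
      intervalIntegral.integral_nonneg
        (branchTop_antitone (fun d => (hτ d).le) (Nat.le_succ d)) fun _ _ => abs_nonneg _
    rw [intervalIntegral.integral_const_mul,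
      intervalIntegral.integral_comp_sub_mul (fun w => |F w|) (hτ d).ne', mul_one, mul_zero,
      sub_zero, ← branchTop_succ, smul_eq_mul, ← mul_assoc]
    refine mul_le_mul_of_nonneg_right ?_ hnn
    rw [← div_eq_mul_inv, div_le_iff₀ (hτ d)]
    exact hστ d
  have hzero : ∀ u ≤ (0 : ℝ), ∫ w in u..(0 : ℝ), |F w| = 0 := by
    intro u hu
    refine intervalIntegral.integral_zero_ae ?_
    have hae : ∀ᵐ w ∂(MeasureTheory.volume : MeasureTheory.Measure ℝ), w ∉ ({0} : Set ℝ) :=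
      MeasureTheory.measure_eq_zero_iff_ae_notMem.mp (by simp)
    filter_upwards [hae] with w hw hwI
    rw [Set.uIoc_of_le hu] at hwI
    rw [hneg w (lt_of_le_of_ne hwI.2 hw), abs_zero]
  have htot : ∫ w in branchTop τ n..1, |F w| ≤ ∫ w in (0 : ℝ)..1, |F w| := by
    have hn1 : branchTop τ n ≤ 1 := by
      have := branchTop_antitone (fun d => (hτ d).le) (Nat.zero_le n)
      rwa [branchTop_zero] at this
    rcases le_total (branchTop τ n) 0 with h | h
    · rw [← intervalIntegral.integral_add_adjacent_intervals (hint _ 0) (hint 0 1), hzero _ h,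
        zero_add]
    · rw [← intervalIntegral.integral_add_adjacent_intervals (hint 0 (branchTop τ n))
        (hint _ 1)]
      have := intervalIntegral.integral_nonneg (μ := MeasureTheory.volume) (f := fun w => |F w|) h
        fun _ _ => abs_nonneg _
      linarith
  have hI : ∫ w in (0 : ℝ)..1, |F w| ≤ c * ∫ w in (0 : ℝ)..1, |F w| := by
    refine hle.trans ?_
    rw [intervalIntegral.integral_finsetSum fun d _ => hint' d]
    refine (Finset.sum_le_sum fun d _ => hbranch d).trans ?_
    rw [← Finset.mul_sum]
    refine mul_le_mul_of_nonneg_left ?_ hc0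
    have hadj := intervalIntegral.sum_integral_adjacent_intervals (n := n) (a := branchTop τ)
      (fun k _ => hint (branchTop τ k) (branchTop τ (k + 1)))
    have : ∑ d ∈ Finset.range n, ∫ w in branchTop τ (d + 1)..branchTop τ d, |F w| =
        ∫ w in branchTop τ n..1, |F w| := by
      rw [intervalIntegral.integral_symm, ← branchTop_zero τ, ← hadj, ← Finset.sum_neg_distrib]
      exact Finset.sum_congr rfl fun d _ => intervalIntegral.integral_symm _ _
    rw [this]; exact htot
  have hI0 : 0 ≤ ∫ w in (0 : ℝ)..1, |F w| :=
    intervalIntegral.integral_nonneg zero_le_one fun _ _ => abs_nonneg _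
  by_contra hne
  have hpos : 0 < |F 0| := abs_pos.mpr hne
  have hev : ∀ᶠ w in nhdsWithin (0 : ℝ) (Ioi 0), |F 0| / 2 < |F w| :=
    (tendsto_stepSum hsum Z 0).abs.eventually (lt_mem_nhds (by linarith))
  obtain ⟨δ, hδ, hsub⟩ := mem_nhdsGT_iff_exists_Ioo_subset.mp hev
  have hδ0 : (0 : ℝ) < δ := hδ
  have hm0 : 0 < min δ 1 := lt_min hδ0 one_pos
  have hlow : (min δ 1) * (|F 0| / 2) ≤ ∫ w in (0 : ℝ)..min δ 1, |F w| := by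
    have := intervalIntegral.integral_mono_on_of_le_Ioo hm0.le
      (intervalIntegrable_const (c := |F 0| / 2)) (hint 0 (min δ 1))
      (fun w hw => (hsub ⟨hw.1, hw.2.trans_le (min_le_left _ _)⟩).le)
    rwa [intervalIntegral.integral_const, sub_zero, smul_eq_mul] at this
  have hsplit := intervalIntegral.integral_add_adjacent_intervals (hint 0 (min δ 1))
    (hint (min δ 1) 1)
  have hrest := intervalIntegral.integral_nonneg (μ := MeasureTheory.volume) (f := fun w => |F w|)
    (min_le_right δ 1) fun _ _ => abs_nonneg _
  have hIpos : 0 < ∫ w in (0 : ℝ)..1, |F w| := by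
    have := mul_pos hm0 (half_pos hpos)
    linarith
  nlinarith

lemma sum_return_le {T : ℕ → ℝ} (hT : ∀ i, 0 ≤ T i) {p : ℕ → Prop} [DecidablePred p] {M : ℝ}
    (hM0 : 0 ≤ M) (hM1 : M < 1) (hret : ∀ i m, i < m → p i → p m → T m ≤ M * T i) (n : ℕ) :
    ∀ i m, i < m → p i →
      ∑ j ∈ Finset.range n, T (m + j) * (if p (m + j) then 1 else 0) ≤ M / (1 - M) * T i := by
  have hK0 : 0 ≤ M / (1 - M) := div_nonneg hM0 (by linarith)
  have hK : (1 + M / (1 - M)) * M = M / (1 - M) := by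
    have : (1 - M) ≠ 0 := by linarith
    field_simp
    ring
  induction n with
  | zero => intro i m _ _; simpa using mul_nonneg hK0 (hT i)
  | succ n ih =>
    intro i m him hi
    have hshift : ∀ j, m + (j + 1) = m + 1 + j := fun j => by omega
    rw [Finset.sum_range_succ', Finset.sum_congr rfl fun j _ => by rw [hshift j], add_zero]
    by_cases hm : p m
    · have h1 := ih m (m + 1) (Nat.lt_succ_self m) hm
      have h2 := mul_le_mul_of_nonneg_left (hret i m him hi hm)
        (show 0 ≤ 1 + M / (1 - M) by linarith)
      rw [← mul_assoc, hK] at h2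
      rw [if_pos hm]
      linarith
    · rw [if_neg hm]
      have h1 := ih i (m + 1) (by omega) hi
      linarith

/-- Orbits starting at `0` for two uniformly ordered families of weights cannot have the same
digits if the weights at successive returns to `0` decay by more than one half. -/
lemma false_of_return_decay {σ τ : ℕ → ℝ} {c : ℝ} (hσ : ∀ d, 0 ≤ σ d)
    (hστ : ∀ d, σ d ≤ c * τ d) (hc : c < 1) (hτ : ∀ d, 0 < τ d) (hτ1 : ∀ d, τ d ≤ 1)
    {b : ℕ → ℕ} {Y Z : ℕ → ℝ} (hY : IsOrbit σ b Y) (hZ : IsOrbit τ b Z) (hY0 : Y 0 = 0)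
    (hZ0 : Z 0 = 0) {n : ℕ} (hb : ∀ i, b i < n) {M : ℝ} (hM0 : 0 ≤ M) (hM : M < 1 / 2)
    (hret : ∀ i m, i < m → Z i ≤ 0 → Z m ≤ 0 → wordWeight σ b m ≤ M * wordWeight σ b i) :
    False := by
  have hc0 : 0 ≤ c := by
    by_contra! h
    linarith [hσ 0, hστ 0, mul_neg_of_neg_of_pos h (hτ 0)]
  have hσc : ∀ d, σ d ≤ c := fun d => (hστ d).trans (mul_le_of_le_one_right hc0 (hτ1 d))
  have hsum : Summable (signedWeight σ b) := summable_signedWeight hσ hσc hc b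
  have hzero := tsum_return_eq_zero hσ hστ hc hτ hτ1 hY hZ hY0 hZ0 hb
  have hs := summable_mul_ite hsum fun i => Z i ≤ 0
  rw [stepSum, hs.tsum_eq_zero_add, hZ0, if_pos le_rfl] at hzero
  have hs' := (summable_nat_add_iff 1).mpr hs
  have hK : M / (1 - M) < 1 := by rw [div_lt_one] <;> linarith
  have hbound : -(M / (1 - M)) ≤
      ∑' i, signedWeight σ b (i + 1) * (if Z (i + 1) ≤ 0 then (1 : ℝ) else 0) := by
    refine ge_of_tendsto' hs'.hasSum.tendsto_sum_nat fun N => ?_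
    have h1 := sum_return_le (wordWeight_nonneg hσ b) (p := fun i => Z i ≤ 0) hM0 (by linarith)
      hret N 0 1 one_pos hZ0.le
    rw [wordWeight_zero, mul_one] at h1
    refine (neg_le_neg h1).trans ?_
    rw [← Finset.sum_neg_distrib]
    refine Finset.sum_le_sum fun i _ => ?_
    rw [add_comm 1 i, ← neg_mul]
    refine mul_le_mul_of_nonneg_right ?_ (by split_ifs <;> simp)
    rw [signedWeight]
    have h0 := wordWeight_nonneg hσ b (i + 1)
    rcases neg_one_pow_eq_or ℝ (i + 1) with h | h <;> rw [h] <;> linarith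
  have hg0 : signedWeight σ b 0 = 1 := by simp [signedWeight, wordWeight_zero]
  rw [hg0] at hzero
  linarith

/-- Two orbits for constant weights `s < t ≤ 1/2` starting at `0` do not share their digits. -/
lemma false_of_const {s t : ℝ} (hs : 0 < s) (hst : s < t) (ht : t ≤ 1 / 2) {b : ℕ → ℕ}
    {Y Z : ℕ → ℝ} (hY : IsOrbit (fun _ => s) b Y) (hZ : IsOrbit (fun _ => t) b Z)
    (hY0 : Y 0 = 0) (hZ0 : Z 0 = 0) {n : ℕ} (hb : ∀ i, b i < n) : False := by
  have ht0 := hs.trans hst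
  refine false_of_return_decay (c := s / t) (fun _ => hs.le)
    (fun _ => (div_mul_cancel₀ s ht0.ne').ge) ((div_lt_one ht0).mpr hst) (fun _ => ht0)
    (fun _ => by linarith) hY hZ hY0 hZ0 hb hs.le (by linarith) fun i m him _ _ => ?_
  have hpow : ∀ i, wordWeight (fun _ => s) b i = s ^ i := fun i => by simp [wordWeight]
  rw [hpow, hpow, ← pow_succ']
  exact pow_le_pow_of_le_one hs.le (by linarith) him

/-- The weights equal to `x` on the digit `0` and to `y` on all other digits. -/
noncomputable def twoSlope (x y : ℝ) (d : ℕ) : ℝ := if d = 0 then x else y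

lemma twoSlope_self (t : ℝ) : twoSlope t t = fun _ => t := by
  funext d; simp [twoSlope]

lemma branchTop_twoSlope_one (x y : ℝ) : branchTop (twoSlope x y) 1 = 1 - x := by
  simp [branchTop, twoSlope]

lemma IsOrbit.step_zero {x y : ℝ} {b : ℕ → ℕ} {Z : ℕ → ℝ} (h : IsOrbit (twoSlope x y) b Z) {i : ℕ}
    (hi : b i = 0) : Z i = 1 - x * Z (i + 1) := by
  rw [h.step i, hi, branchTop_zero]; simp [twoSlope]

lemma IsOrbit.step_one {x y : ℝ} {b : ℕ → ℕ} {Z : ℕ → ℝ} (h : IsOrbit (twoSlope x y) b Z) {i : ℕ}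
    (hi : b i = 1) : Z i = 1 - x - y * Z (i + 1) := by
  rw [h.step i, hi, branchTop_twoSlope_one]; simp [twoSlope]

/-- Two orbits for two pairs of slopes starting at `0` do not share their binary digits, provided
the larger slopes have product at most `1/2`. -/
lemma false_of_twoSlope {x₀ y₀ x₁ y₁ : ℝ} (hx₀ : 0 < x₀) (hy₀ : 0 < y₀) (hx : x₀ < x₁)
    (hy : y₀ < y₁) (hx₁ : x₁ < 1) (hy₁ : y₁ < 1) (hyx : y₀ ≤ x₀) (hM : x₁ * y₁ ≤ 1 / 2)
    {b : ℕ → ℕ} (hb : ∀ i, b i ≤ 1) {Y Z : ℕ → ℝ} (hY : IsOrbit (twoSlope x₀ y₀) b Y)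
    (hZ : IsOrbit (twoSlope x₁ y₁) b Z) (hY0 : Y 0 = 0) (hZ0 : Z 0 = 0) : False := by
  have hpos₀ : ∀ d, 0 ≤ twoSlope x₀ y₀ d := fun d => by unfold twoSlope; split_ifs <;> linarith
  have hpos₁ : ∀ d, 0 < twoSlope x₁ y₁ d := fun d => by unfold twoSlope; split_ifs <;> linarith
  have hle₁ : ∀ d, twoSlope x₁ y₁ d ≤ 1 := fun d => by unfold twoSlope; split_ifs <;> linarith
  have hx₁0 := hx₀.trans hx
  have hy₁0 := hy₀.trans hy
  have hanti : Antitone (wordWeight (twoSlope x₀ y₀) b) := antitone_nat_of_succ_le fun i => by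
    rw [wordWeight_succ]
    refine mul_le_of_le_one_right (wordWeight_nonneg hpos₀ b i) ?_
    unfold twoSlope; split_ifs <;> linarith
  refine false_of_return_decay (c := max (x₀ / x₁) (y₀ / y₁)) (M := x₀ * y₀) hpos₀ (fun d => ?_)
    (max_lt ((div_lt_one hx₁0).mpr hx) ((div_lt_one hy₁0).mpr hy)) hpos₁ hle₁ hY hZ hY0 hZ0
    (fun i => Nat.lt_succ_of_le (hb i)) (mul_pos hx₀ hy₀).le ?_ fun i m him hi hm => ?_
  · unfold twoSlope
    split_ifs
    · exact (div_le_iff₀ hx₁0).mp (le_max_left _ _)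
    · exact (div_le_iff₀ hy₁0).mp (le_max_right _ _)
  · exact (mul_lt_mul'' hx hy hx₀.le hy₀.le).trans_le hM
  · have hi0 : Z i = 0 := le_antisymm hi (hZ.nonneg i)
    have hbi : b i = 1 := by
      rcases Nat.le_one_iff_eq_zero_or_eq_one.mp (hb i) with h | h
      · have h1 := hZ.step_zero h
        have h2 := mul_le_mul_of_nonneg_left (hZ.le_one (fun d => (hpos₁ d).le) (i + 1)) hx₁0.le
        linarith
      · exact h
    have h1 := hZ.step_one hbi
    have hm2 : i + 2 ≤ m := by
      rcases Nat.lt_or_ge m (i + 2) with h | h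
      · obtain rfl : m = i + 1 := by omega
        have := le_antisymm hm (hZ.nonneg _)
        rw [this, hi0] at h1
        linarith
      · exact h
    refine (hanti hm2).trans ?_
    rw [wordWeight_succ, wordWeight_succ, hbi]
    have h2 : twoSlope x₀ y₀ 1 = y₀ := by simp [twoSlope]
    have h3 : twoSlope x₀ y₀ (b (i + 1)) ≤ x₀ := by unfold twoSlope; split_ifs <;> linarith
    have h4 := wordWeight_nonneg hpos₀ b i
    rw [h2]
    have := mul_le_mul_of_nonneg_left h3 (mul_nonneg h4 hy₀.le)
    linarith

lemma mul_le_half_of_prefix_101 {x y : ℝ} (hx : 0 < x) (hx1 : x < 1) (hy : 0 < y)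
    {b : ℕ → ℕ} {Z : ℕ → ℝ} (hZ : IsOrbit (twoSlope x y) b Z) (hZ0 : Z 0 = 0) (h0 : b 0 = 1)
    (h1 : b 1 = 0) (h2 : b 2 = 1) : x * y ≤ 1 / 2 := by
  have e0 := hZ.step_one h0
  have e1 := hZ.step_zero h1
  have e2 := hZ.step_one h2
  have h3 := mul_nonneg hy.le (hZ.nonneg 3)
  norm_num at e0 e1 e2
  have h4 : 1 - x * (1 - x) ≤ Z 1 := by
    have := mul_nonneg hx.le h3
    rw [e1, e2]; linarith
  have h5 := mul_le_mul_of_nonneg_left h4 hy.le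
  nlinarith [mul_nonneg hy.le (sq_nonneg (1 - x))]

lemma mul_le_half_of_prefix_1000 {x y : ℝ} (hx : 0 < x) (hx1 : x < 1) (hy : 0 < y)
    {b : ℕ → ℕ} {Z : ℕ → ℝ} (hZ : IsOrbit (twoSlope x y) b Z) (hZ0 : Z 0 = 0) (h0 : b 0 = 1)
    (h1 : b 1 = 0) (h2 : b 2 = 0) (h3 : b 3 = 0) : x * y ≤ 1 / 2 := by
  have e0 := hZ.step_one h0
  have e1 := hZ.step_zero h1
  have e2 := hZ.step_zero h2
  have e3 := hZ.step_zero h3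
  have h4 : Z 4 ≤ 1 := hZ.le_one (fun d => by unfold twoSlope; split_ifs <;> linarith) 4
  norm_num at e0 e1 e2 e3
  have h5 : (1 - x) * (1 + x ^ 2) ≤ Z 1 := by
    have := mul_le_mul_of_nonneg_left h4 (pow_pos hx 3).le
    rw [e1, e2, e3]; linarith
  have h6 := mul_le_mul_of_nonneg_left h5 hy.le
  have h7 : (1 - x) * (y * (1 + x ^ 2)) ≤ (1 - x) * 1 := by linarith
  have h8 := le_of_mul_le_mul_left h7 (sub_pos.mpr hx1)
  nlinarith [mul_nonneg hy.le (sq_nonneg (1 - x))]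

/-- The alternating lexicographic comparison `x < y`, decided at index `k`. -/
def LexAt (k : ℕ) (x y : ℕ → ℕ) : Prop :=
  (∀ i < k, x i = y i) ∧ if Even k then x k < y k else y k < x k

lemma LexAt.ne {k : ℕ} {x y : ℕ → ℕ} (h : LexAt k x y) : x k ≠ y k := by
  have h2 := h.2
  split_ifs at h2
  exacts [h2.ne, h2.ne']

lemma LexAt.index_eq {j k : ℕ} {x y : ℕ → ℕ} (hj : LexAt j x y) (hk : LexAt k x y) : j = k := by
  rcases lt_trichotomy j k with h | h | h
  · exact absurd (hk.1 j h) hj.ne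
  · exact h
  · exact absurd (hj.1 k h) hk.ne

lemma LexAt.asymm {j k : ℕ} {x y : ℕ → ℕ} (hj : LexAt j x y) (hk : LexAt k y x) : False := by
  rcases lt_trichotomy j k with h | h | h
  · exact hj.ne (hk.1 j h).symm
  · subst h
    have h1 := hj.2
    have h2 := hk.2
    split_ifs at h1 h2 <;> omega
  · exact hk.ne (hj.1 k h).symm

lemma exists_lexAt_or {x y : ℕ → ℕ} (h : x ≠ y) : ∃ k, LexAt k x y ∨ LexAt k y x := by
  classical
  have hex : ∃ k, x k ≠ y k := Function.ne_iff.mp h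
  have hlt : ∀ i < Nat.find hex, x i = y i := fun i hi => not_not.mp (Nat.find_min hex hi)
  have hne := Nat.find_spec hex
  refine ⟨Nat.find hex, ?_⟩
  by_cases he : Even (Nat.find hex)
  · rcases lt_or_gt_of_ne hne with h1 | h1
    · exact Or.inl ⟨hlt, by rwa [if_pos he]⟩
    · exact Or.inr ⟨fun i hi => (hlt i hi).symm, by rwa [if_pos he]⟩
  · rcases lt_or_gt_of_ne hne with h1 | h1
    · exact Or.inr ⟨fun i hi => (hlt i hi).symm, by rwa [if_neg he]⟩
    · exact Or.inl ⟨hlt, by rwa [if_neg he]⟩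

/-- No shift of `b` exceeds `b`. -/
def ShiftMaximal (b : ℕ → ℕ) : Prop := ∀ k j, ¬ LexAt j b fun n => b (n + k)

/-- `b` is the image of the binary sequence `c` under `1 ↦ 100`, `0 ↦ 1`; the image of the `i`-th
letter starts at `N i`. -/
structure Coded (b c N : ℕ → ℕ) : Prop where
  zero : N 0 = 0
  succ : ∀ i, N (i + 1) = N i + if c i = 1 then 3 else 1
  le_one : ∀ i, c i ≤ 1
  head : ∀ i, b (N i) = 1
  tail : ∀ i, c i = 1 → b (N i + 1) = 0 ∧ b (N i + 2) = 0

lemma Coded.succ_of_one {b c N : ℕ → ℕ} (h : Coded b c N) {i : ℕ} (hi : c i = 1) :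
    N (i + 1) = N i + 3 := by rw [h.succ, if_pos hi]

lemma Coded.succ_of_zero {b c N : ℕ → ℕ} (h : Coded b c N) {i : ℕ} (hi : c i = 0) :
    N (i + 1) = N i + 1 := by rw [h.succ, if_neg (by omega)]

lemma Coded.zero_or_one {b c N : ℕ → ℕ} (h : Coded b c N) (i : ℕ) : c i = 0 ∨ c i = 1 :=
  Nat.le_one_iff_eq_zero_or_eq_one.mp (h.le_one i)

lemma Coded.strictMono {b c N : ℕ → ℕ} (h : Coded b c N) : StrictMono N :=
  strictMono_nat_of_lt_succ fun i => by rw [h.succ]; split_ifs <;> omega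

lemma Coded.even_iff {b c N : ℕ → ℕ} (h : Coded b c N) (i : ℕ) : Even (N i) ↔ Even i := by
  induction i with
  | zero => simp [h.zero]
  | succ i ih => rw [h.succ, Nat.even_add, ih]; split_ifs <;> simp [Nat.even_add_one, parity_simps]

lemma Coded.congr {b c N b' c' N' : ℕ → ℕ} (h : Coded b c N) (h' : Coded b' c' N') {j : ℕ}
    (hc : ∀ i < j, c i = c' i) : N j = N' j ∧ ∀ m < N j, b m = b' m := by
  induction j with
  | zero => simp [h.zero, h'.zero]
  | succ j ih =>
    obtain ⟨hN, hb⟩ := ih fun i hi => hc i (hi.trans (Nat.lt_succ_self j))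
    have hcj := hc j (Nat.lt_succ_self j)
    have e1 := h.head j
    have e2 := h'.head j
    rw [← hN] at e2
    rcases h.zero_or_one j with h0 | h1
    · rw [h.succ_of_zero h0, h'.succ_of_zero (hcj ▸ h0), hN]
      refine ⟨rfl, fun m hm => ?_⟩
      rw [← hN] at hm
      rcases Nat.lt_succ_iff_lt_or_eq.mp hm with hm | rfl
      · exact hb m hm
      · rw [e1, e2]
    · have t1 := h.tail j h1
      have t2 := h'.tail j (hcj ▸ h1)
      rw [h.succ_of_one h1, h'.succ_of_one (hcj ▸ h1), hN]
      refine ⟨rfl, fun m hm => ?_⟩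
      rw [← hN] at hm t2
      have : m < N j ∨ m = N j ∨ m = N j + 1 ∨ m = N j + 2 := by omega
      rcases this with hm | rfl | rfl | rfl
      · exact hb m hm
      · rw [e1, e2]
      · rw [t1.1, t2.1]
      · rw [t1.2, t2.2]

lemma Coded.eq_of_eq {b b' c N N' : ℕ → ℕ} (h : Coded b c N) (h' : Coded b' c N') : b = b' := by
  funext m
  exact (h.congr h' (j := m + 1) fun _ _ => rfl).2 m (h.strictMono.le_apply (x := m + 1))

lemma Coded.lexAt {b c N b' c' N' : ℕ → ℕ} (h : Coded b c N) (h' : Coded b' c' N') {j : ℕ}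
    (hj : LexAt j c c') : LexAt (N j + 1) b b' := by
  obtain ⟨hN, hb⟩ := h.congr h' hj.1
  have e1 := h.head j
  have e2 := h'.head j
  rw [← hN] at e2
  have hlt := hj.2
  refine ⟨fun i hi => ?_, ?_⟩
  · rcases Nat.lt_succ_iff_lt_or_eq.mp hi with hi | rfl
    · exact hb i hi
    · rw [e1, e2]
  · have s1 : c j = 0 → b (N j + 1) = 1 := fun h0 => by rw [← h.succ_of_zero h0, h.head]
    have s2 : c' j = 0 → b' (N j + 1) = 1 := fun h0 => by
      rw [hN, ← h'.succ_of_zero h0, h'.head]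
    have t1 := h.tail j
    have t2 := h'.tail j
    rw [← hN] at t2
    have q1 := h.zero_or_one j
    have q2 := h'.zero_or_one j
    have hpar : Even (N j + 1) ↔ ¬ Even j := by rw [Nat.even_add_one, h.even_iff]
    by_cases he : Even j
    · rw [if_pos he] at hlt
      rw [if_neg (fun hn => hpar.mp hn he), s1 (by omega), (t2 (by omega)).1]
      exact one_pos
    · rw [if_neg he] at hlt
      rw [if_pos (hpar.mpr he), s2 (by omega), (t1 (by omega)).1]
      exact one_pos

lemma Coded.shift {b c N : ℕ → ℕ} (h : Coded b c N) (k : ℕ) :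
    Coded (fun n => b (n + N k)) (fun n => c (n + k)) fun i => N (i + k) - N k := by
  have hle : ∀ i, N k ≤ N (i + k) := fun i => h.strictMono.monotone (Nat.le_add_left k i)
  refine ⟨by simp, fun i => ?_, fun i => h.le_one _, fun i => ?_, fun i hi => ?_⟩
  · have := h.succ (i + k)
    rw [add_right_comm, this]
    have := hle i
    omega
  · simp only [Nat.sub_add_cancel (hle i), h.head]
  · have := h.tail _ hi
    have h2 := hle i
    rw [← this.1]
    constructor
    · congr 1; omega
    · rw [this.1, ← this.2]; congr 1; omega

lemma Coded.shiftMaximal {b c N : ℕ → ℕ} (h : Coded b c N) (hb : ShiftMaximal b) :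
    ShiftMaximal c := fun k _ hj => hb (N k) _ (h.lexAt (h.shift k) hj)

lemma exists_coded {b : ℕ → ℕ} (hb : ∀ i, b i ≤ 1) (hmax : ShiftMaximal b) (h0 : b 0 = 1)
    (h1 : b 1 = 0) (h2 : b 2 = 0) (h3 : b 3 = 1) : ∃ c N, Coded b c N := by
  have no101 : ∀ i, b i = 1 → b (i + 1) = 0 → b (i + 2) = 0 := by
    intro i hi hi1
    by_contra hi2
    refine hmax i 2 ⟨fun j hj => ?_, ?_⟩
    · interval_cases j
      · simp [h0, hi]
      · simp [h1, add_comm 1 i, hi1]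
    · rw [if_pos (by decide), h2]; dsimp only; rw [add_comm 2 i]; omega
  have no1000 : ∀ i, b i = 1 → b (i + 1) = 0 → b (i + 2) = 0 → b (i + 3) = 1 := by
    intro i hi hi1 hi2
    by_contra hi3
    refine hmax i 3 ⟨fun j hj => ?_, ?_⟩
    · interval_cases j
      · simp [h0, hi]
      · simp [h1, add_comm 1 i, hi1]
      · simp [h2, add_comm 2 i, hi2]
    · rw [if_neg (by decide), h3]; dsimp only; rw [add_comm 3 i]
      have := hb (i + 3)
      omega
  let N : ℕ → ℕ := fun i => Nat.rec 0 (fun _ n => n + if b (n + 1) = 0 then 3 else 1) i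
  have hN : ∀ i, N (i + 1) = N i + if b (N i + 1) = 0 then 3 else 1 := fun _ => rfl
  have hhead : ∀ i, b (N i) = 1 := by
    intro i
    induction i with
    | zero => exact h0
    | succ i ih =>
      rw [hN]
      split_ifs with hz
      · exact no1000 _ ih hz (no101 _ ih hz)
      · have := hb (N i + 1)
        omega
  refine ⟨fun i => if b (N i + 1) = 0 then 1 else 0, N, rfl, fun i => ?_, fun i => ?_, hhead,
    fun i hi => ?_⟩
  · rw [hN]; split_ifs <;> simp_all
  · split_ifs <;> simp
  · have hz : b (N i + 1) = 0 := by
      by_contra hne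
      simp [hne] at hi
    exact ⟨hz, no101 _ (hhead i) hz⟩

lemma Coded.isOrbit {b c N : ℕ → ℕ} (h : Coded b c N) {x y : ℝ} (hx : x < 1) {Z : ℕ → ℝ}
    (hZ : IsOrbit (twoSlope x y) b Z) :
    IsOrbit (twoSlope y (x ^ 2 * y)) c fun i => Z (N i) / (1 - x) := by
  have hx' : (1 - x) ≠ 0 := by linarith
  refine ⟨fun i => div_nonneg (hZ.nonneg _) (by linarith), fun i => ?_⟩
  have e0 := hZ.step_one (h.head i)
  rcases h.zero_or_one i with h0 | h1
  · rw [h0, branchTop_zero, h.succ_of_zero h0]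
    simp only [twoSlope, if_true]
    rw [e0]; field_simp
  · have e1 := hZ.step_zero (h.tail i h1).1
    have e2 := hZ.step_zero (h.tail i h1).2
    rw [h1, branchTop_twoSlope_one, h.succ_of_one h1]
    simp only [twoSlope, one_ne_zero, if_false]
    rw [e0, e1, e2]; field_simp; ring

/-- The letters of the sequence `uSeq`. -/
def uNat (n : ℕ) : ℕ := (uWord (n + 1)).getD n 0

lemma uWord_prefix_succ (n : ℕ) : uWord n <+: uWord (n + 1) := by
  induction n with
  | zero => exact ⟨[0, 0], rfl⟩
  | succ n ih =>
    obtain ⟨t, ht⟩ := ih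
    refine ⟨t.flatMap phiW, ?_⟩
    change uWord (n + 1) ++ _ = (uWord (n + 1)).flatMap phiW
    rw [← ht, List.flatMap_append, ht]
    rfl

lemma uWord_prefix {m n : ℕ} (h : m ≤ n) : uWord m <+: uWord n := by
  induction n, h using Nat.le_induction with
  | base => exact List.prefix_rfl
  | succ n _ ih => exact ih.trans (uWord_prefix_succ n)

lemma lt_length_uWord (n : ℕ) : n < (uWord n).length := by
  have h1 : ∀ l : List ℕ, l.length ≤ (l.flatMap phiW).length := fun l => by
    induction l with
    | nil => simp
    | cons d l ih =>
      rw [List.flatMap_cons, List.length_append, List.length_cons]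
      have : 1 ≤ (phiW d).length := by unfold phiW; split <;> simp
      omega
  induction n with
  | zero => simp [uWord]
  | succ n ih =>
    obtain ⟨t, ht⟩ := uWord_prefix (Nat.zero_le n)
    have h2 := h1 t
    have h3 : (uWord (n + 1)).length = 3 + (t.flatMap phiW).length := by
      change ((uWord n).flatMap phiW).length = _
      rw [← ht]
      simp [uWord, phiW]
      omega
    rw [← ht] at ih
    simp [uWord] at ih
    omega

lemma getElem_uWord {n i : ℕ} (h : i < (uWord n).length) : (uWord n)[i] = uNat i := by
  have hi : i < (uWord (i + 1)).length := (Nat.lt_succ_self i).trans (lt_length_uWord (i + 1))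
  rw [uNat, List.getD_eq_getElem _ _ hi]
  rcases le_total n (i + 1) with hn | hn
  · exact (uWord_prefix hn).getElem h
  · exact ((uWord_prefix hn).getElem hi).symm

lemma uNat_le_one (i : ℕ) : uNat i ≤ 1 := by
  have : ∀ n, ∀ d ∈ uWord n, d ≤ 1 := by
    intro n
    induction n with
    | zero => simp [uWord]
    | succ n ih =>
      intro d hd
      obtain ⟨e, _, he⟩ := List.mem_flatMap.mp (show d ∈ (uWord n).flatMap phiW from hd)
      unfold phiW at he
      split at he <;> simp at he <;> omega
  rw [← getElem_uWord (lt_length_uWord i)]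
  exact this i _ (List.getElem_mem _)

lemma exists_coded_uNat : ∃ N, Coded uNat uNat N := by
  let N : ℕ → ℕ := fun i => ∑ j ∈ Finset.range i, if uNat j = 1 then 3 else 1
  have key : ∀ i, ∃ p s, uWord (i + 1) = p ++ (phiW (uNat i) ++ s) ∧ p.length = N i := by
    intro i
    have hi := lt_length_uWord i
    refine ⟨((uWord i).take i).flatMap phiW, ((uWord i).drop (i + 1)).flatMap phiW, ?_, ?_⟩
    · rw [← List.flatMap_cons, ← List.flatMap_append, ← getElem_uWord hi,
        ← List.drop_eq_getElem_cons, List.take_append_drop]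
      rfl
    · have : (uWord i).take i = (List.range i).map uNat := by
        refine List.ext_getElem (by simp; omega) fun m h1 h2 => ?_
        simp [getElem_uWord]
      rw [this, List.flatMap_map, List.length_flatMap, ← List.sum_toFinset _ List.nodup_range,
        List.toFinset_range]
      refine Finset.sum_congr rfl fun j _ => ?_
      rcases Nat.le_one_iff_eq_zero_or_eq_one.mp (uNat_le_one j) with h | h <;> simp [h, phiW]
  have hget : ∀ i e, (h : e < (phiW (uNat i)).length) → uNat (N i + e) = (phiW (uNat i))[e] := by
    intro i e h
    obtain ⟨p, s, hw, hp⟩ := key i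
    have hlt : N i + e < (uWord (i + 1)).length := by rw [hw]; simp; omega
    rw [← getElem_uWord hlt]
    simp only [hw]
    rw [List.getElem_append_right (by omega), List.getElem_append_left (by omega)]
    congr 1; omega
  refine ⟨N, by simp [N], fun i => Finset.sum_range_succ _ _, uNat_le_one, fun i => ?_,
    fun i hi => ?_⟩
  · rcases Nat.le_one_iff_eq_zero_or_eq_one.mp (uNat_le_one i) with h | h
    · simpa [h, phiW] using hget i 0
    · simpa [h, phiW] using hget i 0
  · constructor
    · simpa [hi, phiW] using hget i 1
    · simpa [hi, phiW] using hget i 2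

/-- A property of shift-maximal binary sequences exceeding `u` holds if it holds for those with
prefix `101` or `1000` and is inherited through the substitution `1 ↦ 100`, `0 ↦ 1`. -/
theorem renormalization_induction {P : (ℕ → ℕ) → Prop}
    (h101 : ∀ b : ℕ → ℕ, (∀ i, b i ≤ 1) → b 0 = 1 → b 1 = 0 → b 2 = 1 → P b)
    (h1000 : ∀ b : ℕ → ℕ, (∀ i, b i ≤ 1) → b 0 = 1 → b 1 = 0 → b 2 = 0 → b 3 = 0 → P b)
    (hcode : ∀ b c N : ℕ → ℕ, Coded b c N → P c → P b) (k : ℕ) :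
    ∀ b : ℕ → ℕ, (∀ i, b i ≤ 1) → ShiftMaximal b → LexAt k uNat b → P b := by
  induction k using Nat.strong_induction_on with
  | _ k ih =>
  intro b hb hmax hk
  have u0 : uNat 0 = 1 := rfl
  have u1 : uNat 1 = 0 := rfl
  have u2 : uNat 2 = 0 := rfl
  have u3 : uNat 3 = 1 := rfl
  have hlt := hk.2
  rcases Nat.lt_or_ge k 4 with h4 | h4
  · have b0 := hk.1 0
    have b1 := hk.1 1
    have b2 := hk.1 2
    have q0 := hb 0
    have q2 := hb 2
    interval_cases k
    · rw [if_pos (by decide)] at hlt; omega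
    · rw [if_neg (by decide)] at hlt; omega
    · rw [if_pos (by decide)] at hlt
      exact h101 b hb (by omega) (by omega) (by omega)
    · rw [if_neg (by decide)] at hlt
      exact h1000 b hb (by omega) (by omega) (by omega) (by omega)
  · have b0 := hk.1 0 (by omega)
    have b1 := hk.1 1 (by omega)
    have b2 := hk.1 2 (by omega)
    have b3 := hk.1 3 (by omega)
    obtain ⟨c, N, hc⟩ := exists_coded hb hmax (b0 ▸ u0) (b1 ▸ u1) (b2 ▸ u2) (b3 ▸ u3)
    obtain ⟨M, hM⟩ := exists_coded_uNat
    refine hcode b c N hc ?_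
    have hne : uNat ≠ c := by
      rintro rfl
      exact hk.ne (congrFun (hM.eq_of_eq hc) k)
    obtain ⟨j, hj | hj⟩ := exists_lexAt_or hne
    · have hjk := (hM.lexAt hc hj).index_eq hk
      refine ih j ?_ c hc.le_one (hc.shiftMaximal hmax) hj
      have := hM.strictMono.le_apply (x := j)
      omega
    · exact ((hc.lexAt hM hj).asymm hk).elim

/-- `b` does not carry orbits starting at `0` for two ordered pairs of slopes. -/
def Rigid (b : ℕ → ℕ) : Prop :=
  ∀ x₀ y₀ x₁ y₁ : ℝ, 0 < x₀ → 0 < y₀ → x₀ < x₁ → y₀ < y₁ → x₁ < 1 → y₁ < 1 → y₀ ≤ x₀ →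
    ∀ Y Z, IsOrbit (twoSlope x₀ y₀) b Y → IsOrbit (twoSlope x₁ y₁) b Z → Y 0 = 0 → Z 0 = 0 → False

lemma rigid_of_lexAt {k : ℕ} {b : ℕ → ℕ} (hb : ∀ i, b i ≤ 1) (hmax : ShiftMaximal b)
    (hk : LexAt k uNat b) : Rigid b := by
  refine renormalization_induction (P := Rigid) ?_ ?_ ?_ k b hb hmax hk
  · intro b hb h0 h1 h2 x₀ y₀ x₁ y₁ hx₀ hy₀ hx hy hx₁ hy₁ hyx Y Z hY hZ hY0 hZ0
    exact false_of_twoSlope hx₀ hy₀ hx hy hx₁ hy₁ hyx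
      (mul_le_half_of_prefix_101 (hx₀.trans hx) hx₁ (hy₀.trans hy) hZ hZ0 h0 h1 h2)
      hb hY hZ hY0 hZ0
  · intro b hb h0 h1 h2 h3 x₀ y₀ x₁ y₁ hx₀ hy₀ hx hy hx₁ hy₁ hyx Y Z hY hZ hY0 hZ0
    exact false_of_twoSlope hx₀ hy₀ hx hy hx₁ hy₁ hyx
      (mul_le_half_of_prefix_1000 (hx₀.trans hx) hx₁ (hy₀.trans hy) hZ hZ0 h0 h1 h2 h3)
      hb hY hZ hY0 hZ0
  · intro b c N hc ih x₀ y₀ x₁ y₁ hx₀ hy₀ hx hy hx₁ hy₁ hyx Y Z hY hZ hY0 hZ0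
    have hsq : x₀ ^ 2 < x₁ ^ 2 := pow_lt_pow_left₀ hx hx₀.le two_ne_zero
    have hx₁0 := hx₀.trans hx
    have hle : ∀ {x y : ℝ}, 0 < x → x < 1 → 0 < y → x ^ 2 * y ≤ y := fun h0 h1 hy =>
      mul_le_of_le_one_left hy.le (pow_le_one₀ h0.le h1.le)
    exact ih y₀ (x₀ ^ 2 * y₀) y₁ (x₁ ^ 2 * y₁) hy₀ (by positivity) hy
      (mul_lt_mul'' hsq hy (by positivity) hy₀.le) hy₁
      ((hle hx₁0 hx₁ (hy₀.trans hy)).trans_lt hy₁) (hle hx₀ (hx.trans hx₁) hy₀) _ _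
      (hc.isOrbit (hx.trans hx₁) hY) (hc.isOrbit hx₁ hZ) (by simp [hc.zero, hY0])
      (by simp [hc.zero, hZ0])

/-- For all exponents `p` and `q`, some `t` admits no orbit of `b` for the slopes `t ^ p`, `t ^ q`. -/
def Escapes (b : ℕ → ℕ) : Prop :=
  ∀ p q : ℕ, 0 < p → 0 < q → ∃ t : ℝ, 0 < t ∧ t < 1 ∧
    ∀ Z, ¬ IsOrbit (twoSlope (t ^ p) (t ^ q)) b Z

lemma exists_lt_one_of_tendsto {f : ℝ → ℝ} (hf : Continuous f) {v : ℝ} (h : v < f 1) :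
    ∃ t, 0 < t ∧ t < 1 ∧ v < f t := by
  have h1 : ∀ᶠ t in nhdsWithin (1 : ℝ) (Iio 1), v < f t :=
    (hf.tendsto 1).mono_left nhdsWithin_le_nhds |>.eventually (lt_mem_nhds h)
  obtain ⟨t, ht, h0⟩ := (h1.and (Ioo_mem_nhdsLT one_pos)).exists
  exact ⟨t, h0.1, h0.2, ht⟩

lemma escapes_of_lexAt {k : ℕ} {b : ℕ → ℕ} (hb : ∀ i, b i ≤ 1) (hmax : ShiftMaximal b)
    (hk : LexAt k uNat b) : Escapes b := by
  refine renormalization_induction (P := Escapes) ?_ ?_ ?_ k b hb hmax hk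
  · intro b hb h0 h1 h2 p q hp hq
    obtain ⟨t, ht0, ht1, ht⟩ := exists_lt_one_of_tendsto (v := 0)
      (f := fun t : ℝ => t ^ q * (1 - t ^ p * (1 - t ^ p)) - (1 - t ^ p)) (by fun_prop)
      (by norm_num)
    refine ⟨t, ht0, ht1, fun Z hZ => ?_⟩
    have hx := pow_pos ht0 p
    have hy := pow_pos ht0 q
    have e0 := hZ.step_one h0
    have e1 := hZ.step_zero h1
    have e2 := hZ.step_one h2
    norm_num at e0 e1 e2
    have h3 := mul_nonneg hy.le (hZ.nonneg 3)
    have h4 : t ^ q * (t ^ p * Z 2) ≤ t ^ q * (t ^ p * (1 - t ^ p)) :=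
      mul_le_mul_of_nonneg_left (mul_le_mul_of_nonneg_left (by linarith) hx.le) hy.le
    have h5 := hZ.nonneg 0
    rw [e0, e1] at h5
    linarith
  · intro b hb h0 h1 h2 h3 p q hp hq
    obtain ⟨t, ht0, ht1, ht⟩ := exists_lt_one_of_tendsto (v := 1)
      (f := fun t : ℝ => t ^ q * (1 + (t ^ p) ^ 2)) (by fun_prop) (by norm_num)
    refine ⟨t, ht0, ht1, fun Z hZ => ?_⟩
    have hx := pow_pos ht0 p
    have hx1 : t ^ p < 1 := pow_lt_one₀ ht0.le ht1 hp.ne'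
    have hy := pow_pos ht0 q
    have e0 := hZ.step_one h0
    have e1 := hZ.step_zero h1
    have e2 := hZ.step_zero h2
    have e3 := hZ.step_zero h3
    norm_num at e0 e1 e2 e3
    generalize t ^ p = x at *
    generalize t ^ q = y at *
    have h4 : Z 4 ≤ 1 := hZ.le_one (fun d => by unfold twoSlope; split_ifs <;> linarith) 4
    have h5 := mul_le_mul_of_nonneg_left h4 (mul_pos hy (pow_pos hx 3)).le
    have h6 := hZ.nonneg 0
    rw [e0, e1, e2, e3] at h6
    have h7 := mul_lt_mul_of_pos_left ht (sub_pos.mpr hx1)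
    linarith
  · intro b c N hc ih p q hp hq
    obtain ⟨t, ht0, ht1, ht⟩ := ih q (2 * p + q) hq (by omega)
    refine ⟨t, ht0, ht1, fun Z hZ => ?_⟩
    have := hc.isOrbit (pow_lt_one₀ ht0.le ht1 hp.ne') hZ
    rw [show (t ^ p) ^ 2 * t ^ q = t ^ (2 * p + q) by ring] at this
    exact ht _ this

/-- The value of the tail of `b` starting at index `k` in base `-1/t`, translated so that the
admissible range is `[0, 1]`. -/
noncomputable def tailValue (b : ℕ → ℕ) (t : ℝ) (k : ℕ) : ℝ :=
  1 / (1 + t) + ∑' j : ℕ, (b (k + j) : ℝ) * (-t) ^ (j + 1)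

lemma norm_tail_term_le {b : ℕ → ℕ} {A : ℕ} (hA : ∀ i, b i ≤ A) {t r : ℝ} (ht : |t| ≤ r)
    (k j : ℕ) : ‖(b (k + j) : ℝ) * (-t) ^ (j + 1)‖ ≤ A * r ^ (j + 1) := by
  rw [norm_mul, norm_pow, norm_neg, Real.norm_eq_abs t, Real.norm_of_nonneg (Nat.cast_nonneg _)]
  have : (b (k + j) : ℝ) ≤ A := by exact_mod_cast hA _
  gcongr

lemma summable_mul_pow_succ {r : ℝ} (hr0 : 0 ≤ r) (hr1 : r < 1) (A : ℝ) :
    Summable fun j : ℕ => A * r ^ (j + 1) :=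
  ((summable_nat_add_iff 1).mpr (summable_geometric_of_lt_one hr0 hr1)).mul_left A

lemma summable_tail {b : ℕ → ℕ} {A : ℕ} (hA : ∀ i, b i ≤ A) {t : ℝ} (ht0 : 0 ≤ t) (ht1 : t < 1)
    (k : ℕ) : Summable fun j : ℕ => (b (k + j) : ℝ) * (-t) ^ (j + 1) :=
  .of_norm_bounded (summable_mul_pow_succ ht0 ht1 A)
    fun j => norm_tail_term_le hA (abs_of_nonneg ht0).le k j

lemma tailValue_step {b : ℕ → ℕ} {A : ℕ} (hA : ∀ i, b i ≤ A) {t : ℝ} (ht0 : 0 ≤ t) (ht1 : t < 1)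
    (k : ℕ) : tailValue b t k = 1 - t * b k - t * tailValue b t (k + 1) := by
  have h1 : (1 + t) ≠ 0 := by linarith
  have hs : ∑' j : ℕ, (b (k + (j + 1)) : ℝ) * (-t) ^ (j + 1 + 1) =
      -t * ∑' j : ℕ, (b (k + 1 + j) : ℝ) * (-t) ^ (j + 1) := by
    rw [← tsum_mul_left]
    refine tsum_congr fun j => ?_
    rw [show k + (j + 1) = k + 1 + j by omega]; ring
  rw [tailValue, (summable_tail hA ht0 ht1 k).tsum_eq_zero_add, hs, tailValue]
  simp only [add_zero, zero_add, pow_one]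
  field_simp
  ring

lemma abs_tailValue_le {b : ℕ → ℕ} {A : ℕ} (hA : ∀ i, b i ≤ A) {t : ℝ} (ht0 : 0 ≤ t) (ht1 : t < 1)
    (k : ℕ) : |tailValue b t k| ≤ 1 / (1 + t) + ∑' j : ℕ, (A : ℝ) * t ^ (j + 1) := by
  refine (abs_add_le _ _).trans (add_le_add (abs_of_nonneg (by positivity)).le ?_)
  exact tsum_of_norm_bounded (summable_mul_pow_succ ht0 ht1 A).hasSum
    fun j => norm_tail_term_le hA (abs_of_nonneg ht0).le k j

lemma tailValue_zero_param (b : ℕ → ℕ) (k : ℕ) : tailValue b 0 k = 1 := by simp [tailValue]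

lemma continuousOn_tailValue {b : ℕ → ℕ} {A : ℕ} (hA : ∀ i, b i ≤ A) {r : ℝ} (hr0 : 0 ≤ r)
    (hr1 : r < 1) (k : ℕ) : ContinuousOn (fun t => tailValue b t k) (Icc 0 r) := by
  refine ContinuousOn.add (ContinuousOn.div (by fun_prop) (by fun_prop) fun t ht => ?_)
    (continuousOn_tsum (fun j => by fun_prop) (summable_mul_pow_succ hr0 hr1 A)
      fun j t ht => norm_tail_term_le hA (by rw [abs_of_nonneg ht.1]; exact ht.2) k j)
  linarith [ht.1]

lemma isOrbit_tailValue {b : ℕ → ℕ} {A : ℕ} (hA : ∀ i, b i ≤ A) {t : ℝ} (ht0 : 0 ≤ t)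
    (ht1 : t < 1) (h : ∀ k, 0 ≤ tailValue b t k) : IsOrbit (fun _ => t) b (tailValue b t) := by
  refine ⟨h, fun k => ?_⟩
  rw [tailValue_step hA ht0 ht1 k]
  simp [branchTop, mul_comm]

lemma tailValue_zero_le {b : ℕ → ℕ} {A : ℕ} (hA : ∀ i, b i ≤ A) (hmax : ShiftMaximal b) {t : ℝ}
    (ht0 : 0 ≤ t) (ht1 : t < 1) (h : ∀ k, 0 ≤ tailValue b t k) (k : ℕ) :
    tailValue b t 0 ≤ tailValue b t k := by
  have hle : ∀ i, tailValue b t i ≤ 1 := (isOrbit_tailValue hA ht0 ht1 h).le_one fun _ => ht0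
  by_cases heq : b = fun n => b (n + k)
  · refine le_of_eq ?_
    simp only [tailValue, zero_add]
    congr 1
    refine tsum_congr fun j => ?_
    rw [add_comm k j]
    exact congrArg (fun d : ℕ => (d : ℝ) * (-t) ^ (j + 1)) (congrFun heq j)
  · obtain ⟨j, hj | hj⟩ := exists_lexAt_or heq
    · exact (hmax k j hj).elim
    have hdiff : ∀ m ≤ j, tailValue b t k - tailValue b t 0 =
        (-t) ^ m * (tailValue b t (m + k) - tailValue b t m) := by
      intro m
      induction m with
      | zero => intro _; simp
      | succ m ih =>
        intro hm
        have hd : b (m + k) = b m := hj.1 m hm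
        rw [ih (by omega), tailValue_step hA ht0 ht1 (m + k), tailValue_step hA ht0 ht1 m, hd,
          show m + 1 + k = m + k + 1 by omega]
        ring
    have hD : ∀ {d e : ℕ} {v w : ℝ}, d < e → 0 ≤ w → v ≤ 1 →
        0 ≤ (1 - t * d - t * v) - (1 - t * e - t * w) := by
      intro d e v w hde hw hv
      have h1 : (d : ℝ) + 1 ≤ e := by exact_mod_cast hde
      have h2 := mul_nonneg ht0 (show 0 ≤ (e : ℝ) + w - d - v by linarith)
      linarith
    have hlt := hj.2
    have key := hdiff j le_rfl
    rw [tailValue_step hA ht0 ht1 (j + k), tailValue_step hA ht0 ht1 j] at key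
    split_ifs at hlt with he
    · have := mul_nonneg (he.pow_nonneg (-t)) (hD hlt (h (j + 1)) (hle (j + k + 1)))
      linarith
    · have := mul_nonneg_of_nonpos_of_nonpos
        ((Nat.not_even_iff_odd.mp he).pow_nonpos (neg_nonpos.mpr ht0))
        (neg_nonpos.mpr (hD hlt (h (j + k + 1)) (hle (j + 1))))
      linarith

lemma abs_tailValue_sub_le {b : ℕ → ℕ} {A : ℕ} (hA : ∀ i, b i ≤ A) {s t : ℝ} (hs0 : 0 ≤ s)
    (hst : s ≤ t) (ht1 : t < 1) (h : ∀ k, 0 ≤ tailValue b s k) (k : ℕ) :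
    |tailValue b t k - tailValue b s k| ≤ (t - s) * (A + 1) / (1 - t) := by
  have ht0 := hs0.trans hst
  have hs1 := hst.trans_lt ht1
  have hle : ∀ i, tailValue b s i ≤ 1 := (isOrbit_tailValue hA hs0 hs1 h).le_one fun _ => hs0
  set C := (t - s) * (A + 1) / (1 - t) with hC
  have hC0 : 0 ≤ C := div_nonneg (mul_nonneg (by linarith) (by positivity)) (by linarith)
  have hCeq : (t - s) * (A + 1) + t * C = C := by
    have : (1 - t) ≠ 0 := by linarith
    rw [hC]; field_simp; ring
  obtain ⟨B, hB⟩ : ∃ B, ∀ k, |tailValue b t k - tailValue b s k| ≤ B :=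
    ⟨_, fun k => (abs_sub _ _).trans
      (add_le_add (abs_tailValue_le hA ht0 ht1 k) (abs_tailValue_le hA hs0 hs1 k))⟩
  have hB0 : 0 ≤ B := (abs_nonneg _).trans (hB 0)
  have hn : ∀ n k, |tailValue b t k - tailValue b s k| ≤ C + t ^ n * B := by
    intro n
    induction n with
    | zero => intro k; linarith [hB k]
    | succ n ih =>
      intro k
      have h1 : tailValue b t k - tailValue b s k = -((t - s) * (b k + tailValue b s (k + 1))) +
          -(t * (tailValue b t (k + 1) - tailValue b s (k + 1))) := by
        rw [tailValue_step hA ht0 ht1 k, tailValue_step hA hs0 hs1 k]; ring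
      have h2 : (b k : ℝ) ≤ A := by exact_mod_cast hA k
      have h3 : |(t - s) * (b k + tailValue b s (k + 1))| ≤ (t - s) * (A + 1) := by
        rw [abs_of_nonneg (mul_nonneg (by linarith)
          (add_nonneg (Nat.cast_nonneg _) (h (k + 1))))]
        exact mul_le_mul_of_nonneg_left (add_le_add h2 (hle _)) (by linarith)
      have h4 := mul_le_mul_of_nonneg_left (ih (k + 1)) ht0
      calc _ ≤ (t - s) * (A + 1) + t * |tailValue b t (k + 1) - tailValue b s (k + 1)| := by
            rw [h1]
            refine (abs_add_le _ _).trans ?_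
            rw [abs_neg, abs_neg, abs_mul t, abs_of_nonneg ht0]
            linarith
        _ ≤ (t - s) * (A + 1) + t * (C + t ^ n * B) := by linarith
        _ = C + t ^ (n + 1) * B := by rw [pow_succ]; linarith
  have hlim : Tendsto (fun n : ℕ => C + t ^ n * B) atTop (nhds (C + 0 * B)) :=
    ((tendsto_pow_atTop_nhds_zero_of_lt_one ht0 ht1).mul_const B).const_add C
  rw [zero_mul, add_zero] at hlim
  exact ge_of_tendsto' hlim fun n => hn n k

/-- If no orbit of `b` starts at `0`, then orbits of `b` exist for all parameters below `1`. -/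
lemma tailValue_nonneg_of_forall_ne {b : ℕ → ℕ} {A : ℕ} (hA : ∀ i, b i ≤ A)
    (hmax : ShiftMaximal b)
    (hne : ∀ t, 0 < t → t < 1 → (∀ k, 0 ≤ tailValue b t k) → tailValue b t 0 ≠ 0) {r : ℝ}
    (hr0 : 0 ≤ r) (hr1 : r < 1) (k : ℕ) : 0 ≤ tailValue b r k := by
  suffices Icc 0 r ⊆ {t | ∀ k, 0 ≤ tailValue b t k} from this (right_mem_Icc.mpr hr0) k
  refine IsClosed.Icc_subset_of_forall_exists_gt ?_ (fun k => ?_) ?_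
  · have : {t | ∀ k, 0 ≤ tailValue b t k} ∩ Icc 0 r =
        ⋂ k, Icc 0 r ∩ (fun t => tailValue b t k) ⁻¹' Ici 0 := by
      ext t
      simp only [mem_inter_iff, mem_ofPred_eq, mem_iInter, mem_preimage, mem_Ici]
      exact ⟨fun h k => ⟨h.2, h.1 k⟩, fun h => ⟨fun k => (h k).2, (h 0).1⟩⟩
    rw [this]
    exact isClosed_iInter fun k =>
      (continuousOn_tailValue hA hr0 hr1 k).preimage_isClosed_of_isClosed isClosed_Icc isClosed_Ici
  · rw [tailValue_zero_param]; exact zero_le_one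
  · rintro s ⟨hs, hs0, hsr⟩ v hv
    have hs1 := hsr.trans hr1
    have hpos : 0 < tailValue b s 0 := by
      rcases hs0.eq_or_lt with rfl | h0
      · rw [tailValue_zero_param]; exact one_pos
      · exact lt_of_le_of_ne (hs 0) (Ne.symm (hne s h0 hs1 hs))
    have hr' : 0 < 1 - r := by linarith
    have hA' : (0 : ℝ) < A + 1 := by positivity
    set δ := tailValue b s 0 * (1 - r) / (A + 1) with hδ
    have hδ0 : 0 < δ := by positivity
    have hsv : s < v := hv
    refine ⟨min (min v r) (s + δ), fun k => ?_, lt_min (lt_min hsv hsr) (by linarith),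
      (min_le_left _ _).trans (min_le_left _ _)⟩
    set t := min (min v r) (s + δ) with ht
    have hst : s ≤ t := le_min (le_min hsv.le hsr.le) (by linarith)
    have htr : t ≤ r := (min_le_left _ _).trans (min_le_right _ _)
    have htδ : t ≤ s + δ := min_le_right _ _
    have h1 := abs_tailValue_sub_le hA hs0 hst (htr.trans_lt hr1) hs k
    have h2 := tailValue_zero_le hA hmax hs0 hs1 hs k
    have h3 : (t - s) * (A + 1) / (1 - t) ≤ tailValue b s 0 := by
      rw [div_le_iff₀ (by linarith)]
      calc (t - s) * (A + 1) ≤ δ * (A + 1) := by gcongr; linarith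
        _ = tailValue b s 0 * (1 - r) := by rw [hδ]; field_simp
        _ ≤ tailValue b s 0 * (1 - t) := by gcongr
    linarith [(abs_le.mp h1).1]

lemma one_le_of_lexAt {k : ℕ} {b : ℕ → ℕ} (hk : LexAt k uNat b) : 1 ≤ b 0 := by
  have u0 : uNat 0 = 1 := rfl
  rcases Nat.eq_zero_or_pos k with rfl | h
  · have := hk.2
    rw [if_pos (by decide)] at this
    omega
  · rw [← hk.1 0 h, u0]

lemma ShiftMaximal.le_zero {b : ℕ → ℕ} (hmax : ShiftMaximal b) (i : ℕ) : b i ≤ b 0 := by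
  by_contra! h
  exact hmax i 0 ⟨fun j hj => absurd hj (Nat.not_lt_zero j), by simpa using h⟩

lemma exists_tailValue_eq_zero {k : ℕ} {b : ℕ → ℕ} (hmax : ShiftMaximal b)
    (hk : LexAt k uNat b) :
    ∃ t, 0 < t ∧ t < 1 ∧ (∀ k, 0 ≤ tailValue b t k) ∧ tailValue b t 0 = 0 := by
  by_contra! hne
  have hA := hmax.le_zero
  have hall := fun {r : ℝ} => tailValue_nonneg_of_forall_ne hA hmax hne (r := r)
  rcases (one_le_of_lexAt hk).eq_or_lt with h1 | h2
  · obtain ⟨t, ht0, ht1, ht⟩ := escapes_of_lexAt (fun i => h1 ▸ hA i) hmax hk 1 1 one_pos one_pos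
    rw [pow_one, twoSlope_self] at ht
    exact ht _ (isOrbit_tailValue hA ht0.le ht1 (hall ht0.le ht1))
  · have h0 := hall (r := 3 / 4) (by norm_num) (by norm_num) 0
    have h3 := hall (r := 3 / 4) (by norm_num) (by norm_num) 1
    rw [tailValue_step hA (by norm_num) (by norm_num)] at h0
    have : (2 : ℝ) ≤ b 0 := by exact_mod_cast h2
    linarith

lemma tailValue_parameter_unique {k : ℕ} {b : ℕ → ℕ} (hmax : ShiftMaximal b)
    (hk : LexAt k uNat b) {s t : ℝ} (hs0 : 0 < s) (hst : s < t) (ht1 : t < 1)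
    (hs : ∀ k, 0 ≤ tailValue b s k) (hs' : tailValue b s 0 = 0)
    (ht : ∀ k, 0 ≤ tailValue b t k) (ht' : tailValue b t 0 = 0) : False := by
  have hA := hmax.le_zero
  have ht0 := hs0.trans hst
  have hY := isOrbit_tailValue hA hs0.le (hst.trans ht1) hs
  have hZ := isOrbit_tailValue hA ht0.le ht1 ht
  rcases (one_le_of_lexAt hk).eq_or_lt with h1 | h2
  · rw [← twoSlope_self] at hY hZ
    exact rigid_of_lexAt (fun i => h1 ▸ hA i) hmax hk s s t t hs0 hs0 hst hst ht1 ht1 le_rfl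
      _ _ hY hZ hs' ht'
  · refine false_of_const hs0 hst ?_ hY hZ hs' ht' fun i => Nat.lt_succ_of_le (hA i)
    have h3 := tailValue_step hA ht0.le ht1 0
    have h4 := mul_nonneg ht0.le (ht 1)
    have h5 : t * 2 ≤ t * b 0 := by gcongr; exact_mod_cast h2
    rw [ht'] at h3
    linarith

lemma tsum_div_neg_pow (b : ℕ → ℕ) (β : ℝ) (k : ℕ) :
    ∑' j : ℕ, (b (k + j) : ℝ) / (-β) ^ (j + 1) = tailValue b (1 / β) k - 1 / (1 + 1 / β) := by
  rw [tailValue, add_sub_cancel_left]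
  refine tsum_congr fun j => ?_
  rw [div_eq_mul_inv, ← inv_pow, inv_neg, one_div]

/-- The admissibility of `β` in terms of the orbit with slope `1 / β`. -/
lemma admissible_iff {b : ℕ → ℕ} {A : ℕ} (hA : ∀ i, b i ≤ A) {β : ℝ} (hβ : 1 < β) :
    ((∑' j : ℕ, (b j : ℝ) / (-β) ^ (j + 1)) = -β / (β + 1) ∧
      ∀ k : ℕ, 1 ≤ k → (∑' j : ℕ, (b (k + j) : ℝ) / (-β) ^ (j + 1)) ∈
        Set.Icc (-β / (β + 1)) (1 / (β + 1))) ↔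
      (∀ k, 0 ≤ tailValue b (1 / β) k) ∧ tailValue b (1 / β) 0 = 0 := by
  have hβ0 : 0 < β := one_pos.trans hβ
  have ht0 : 0 ≤ 1 / β := by positivity
  have ht1 : 1 / β < 1 := (div_lt_one hβ0).mpr hβ
  have e1 : -β / (β + 1) = -(1 / (1 + 1 / β)) := by field_simp
  have e2 : 1 / (β + 1) = 1 - 1 / (1 + 1 / β) := by field_simp; ring
  have h0 := tsum_div_neg_pow b β 0
  simp only [zero_add] at h0
  simp only [h0, tsum_div_neg_pow, Set.mem_Icc]
  rw [e1, e2]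
  constructor
  · rintro ⟨h, hk⟩
    have hz : tailValue b (1 / β) 0 = 0 := by linarith
    refine ⟨fun k => ?_, hz⟩
    rcases Nat.eq_zero_or_pos k with rfl | hpos
    · exact hz.ge
    · linarith [(hk k hpos).1]
  · rintro ⟨hk, h⟩
    have hle := (isOrbit_tailValue hA ht0 ht1 hk).le_one fun _ => ht0
    exact ⟨by linarith, fun k _ => ⟨by linarith [hk k], by linarith [hle k]⟩⟩

lemma exists_lexAt_of_altLt {x y : ℕ → ℕ}
    (h : AltLt (fun n => (x n : ℤ)) fun n => (y n : ℤ)) : ∃ k, LexAt k x y := by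
  obtain ⟨k, h1, h2⟩ := h
  dsimp only at h1 h2
  exact ⟨k, fun i hi => by exact_mod_cast h1 i hi, by exact_mod_cast h2⟩

lemma shiftMaximal_of_condG {b : ℕ → ℕ} (h : CondG fun n => (b n : ℤ)) : ShiftMaximal b := by
  intro k j hj
  rcases Nat.eq_zero_or_pos k with rfl | hk
  · exact hj.ne rfl
  · rcases h k hk with hlt | heq
    · obtain ⟨i, hi⟩ := exists_lexAt_of_altLt (x := fun n => b (n + k)) hlt
      exact hi.asymm hj
    · exact hj.ne (Int.ofNat_inj.mp (congrFun heq j)).symm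

end NegBeta

/-- under (G) and (L) there is a unique β > 1 with
Σ_{j≥1} a_j/(−β)^j = −β/(β+1) and all shifted sums in the closed interval. -/
theorem stmt_1 (a : ℕ → ℤ) (hpos : ∀ n, 0 ≤ a n) (hG : CondG a) (hL : CondL a) :
    ∃! β : ℝ, 1 < β ∧
      (∑' j : ℕ, (a j : ℝ) / (-β) ^ (j + 1)) = -β / (β + 1) ∧
      ∀ k : ℕ, 1 ≤ k →
        (∑' j : ℕ, (a (k + j) : ℝ) / (-β) ^ (j + 1)) ∈
          Set.Icc (-β / (β + 1)) (1 / (β + 1)) := by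
  lift a to ℕ → ℕ using hpos
  have hmax := NegBeta.shiftMaximal_of_condG hG
  obtain ⟨k, hk⟩ := NegBeta.exists_lexAt_of_altLt (x := NegBeta.uNat) hL
  have hiff := fun β => NegBeta.admissible_iff hmax.le_zero (β := β)
  simp only [Int.cast_natCast]
  obtain ⟨t, ht0, ht1, ht, ht'⟩ := NegBeta.exists_tailValue_eq_zero hmax hk
  refine ⟨1 / t, ⟨(one_lt_div ht0).mpr ht1, (hiff _ ((one_lt_div ht0).mpr ht1)).mpr ?_⟩, ?_⟩
  · rw [one_div_one_div]; exact ⟨ht, ht'⟩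
  · rintro β ⟨hβ, hadm⟩
    obtain ⟨hs, hs'⟩ := (hiff β hβ).mp hadm
    have hβ0 : 0 < β := one_pos.trans hβ
    have hs0 : 0 < 1 / β := by positivity
    have hs1 : 1 / β < 1 := (div_lt_one hβ0).mpr hβ
    rcases lt_trichotomy (1 / β) t with h | h | h
    · exact (NegBeta.tailValue_parameter_unique hmax hk hs0 h ht1 hs hs' ht ht').elim
    · rw [← h, one_div_one_div]
    · exact (NegBeta.tailValue_parameter_unique hmax hk ht0 h hs1 ht ht' hs hs').elim
end
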